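/- Let 𝐌 be the Polish space of infinite minimal subshifts. The set { X ∈ 𝐌 : X is a strong Toeplitz subshift of rank 2 } is comeager in 𝐌; in fact it contains a dense G_δ subset of 𝐌. -/

import Mathlib

namespace ToeplitzFR

open Set

variable {A B C : Type*}

/-- The shift map `S` on `ℤ → A`: `S(x)(i) = x(i+1)`. -/
def shift (x : ℤ → A) : ℤ → A := fun i => x (i + 1)

/-- The inverse shift map `S⁻¹`. -/
def shiftInv (x : ℤ → A) : ℤ → A := fun i => x (i - 1)

/-- The shift by `k`: `S^k`. -/
def shiftBy (k : ℤ) (x : ℤ → A) : ℤ → A := fun i => x (i + k)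

/-- The finite word `x[i, i+n)`. -/
def factorAt (x : ℤ → A) (i : ℤ) (n : ℕ) : List A :=
  (List.range n).map fun j => x (i + j)

/-- `x` is a periodic point of the shift. -/
def IsPeriodicPoint (x : ℤ → A) : Prop := ∃ p : ℕ, 0 < p ∧ ∀ i : ℤ, x (i + p) = x i

def IsAperiodicPoint (x : ℤ → A) : Prop := ¬ IsPeriodicPoint x

/-- `Per_p(x)`. -/
def PerSet (x : ℤ → A) (p : ℕ) : Set ℤ := {i : ℤ | ∀ k : ℤ, x (i + k * p) = x i}

/-- `Per(x) = ⋃_{p>1} Per_p(x)`. -/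
def PerAll (x : ℤ → A) : Set ℤ := {i : ℤ | ∃ p : ℕ, 1 < p ∧ i ∈ PerSet x p}

/-- `x` is a Toeplitz sequence. -/
def IsToeplitz (x : ℤ → A) : Prop := ∀ i : ℤ, ∃ p : ℕ, 1 < p ∧ i ∈ PerSet x p

/-- The shift orbit of `x`. -/
def orbit (x : ℤ → A) : Set (ℤ → A) := {y | ∃ k : ℤ, y = shiftBy k x}

/-- `X` is the Toeplitz subshift generated by the Toeplitz sequence `x`. -/
def ToeplitzGenerates [TopologicalSpace A] (x : ℤ → A) (X : Set (ℤ → A)) : Prop :=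
  IsToeplitz x ∧ X = closure (orbit x)

/-- `X` is a Toeplitz subshift. -/
def IsToeplitzSubshift [TopologicalSpace A] (X : Set (ℤ → A)) : Prop :=
  ∃ x : ℤ → A, ToeplitzGenerates x X

/-- The `p`-skeleton of `x`, with `none` as the blank symbol. -/
noncomputable def Skel (x : ℤ → A) (p : ℕ) : ℤ → Option A :=
  fun i => @ite _ (i ∈ PerSet x p) (Classical.dec _) (some (x i)) none

/-- `p` is an essential period of `x`. -/
def IsEssentialPeriod (x : ℤ → A) (p : ℕ) : Prop :=
  1 < p ∧ ∀ q : ℕ, 0 < q → q < p → ∃ i : ℤ, Skel x p (i + q) ≠ Skel x p i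

/-- `(P n)` is a period structure for `x`. -/
def IsPeriodStructure (x : ℤ → A) (P : ℕ → ℕ) : Prop :=
  StrictMono P ∧ (∀ n, IsEssentialPeriod x (P n)) ∧ (∀ n, P n ∣ P (n+1)) ∧
    ∀ i : ℤ, ∃ n, i ∈ PerSet x (P n)

/-- `q` divides the scale of the Toeplitz subshift `X`. -/
def DividesScale [TopologicalSpace A] (X : Set (ℤ → A)) (q : ℕ) : Prop :=
  ∃ (x : ℤ → A) (P : ℕ → ℕ),
    ToeplitzGenerates x X ∧ IsPeriodStructure x P ∧ ∃ n, q ∣ P n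

/-! ### Directive sequences and S-adic subshifts -/

/-- All morphisms in the directive sequence are non-erasing. -/
def NonErasing {A : ℕ → Type*} (τ : ∀ n, A (n+1) → List (A n)) : Prop :=
  ∀ n a, τ n a ≠ []

/-- The directive sequence has constant length. -/
def ConstantLength {A : ℕ → Type*} (τ : ∀ n, A (n+1) → List (A n)) : Prop :=
  ∀ n, ∀ a b : A (n+1), (τ n a).length = (τ n b).length

/-- The directive sequence is proper. -/
def ProperSeq {A : ℕ → Type*} (τ : ∀ n, A (n+1) → List (A n)) : Prop :=
  ∀ n, ∃ b c : A n, ∀ a : A (n+1), (τ n a).head? = some b ∧ (τ n a).getLast? = some c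

/-- `sadicWordAux τ n k a = τ_{[n, n+k)}(a)`. -/
def sadicWordAux {A : ℕ → Type*} (τ : ∀ n, A (n+1) → List (A n)) (n : ℕ) :
    ∀ k : ℕ, A (n + k) → List (A n)
  | 0, a => [a]
  | (k+1), a => (τ (n+k) a).flatMap (sadicWordAux τ n k)

/-- `word0 τ k a = τ_{[0, k)}(a)` for `a ∈ A k`. -/
def word0 {A : ℕ → Type*} (τ : ∀ n, A (n+1) → List (A n)) :
    ∀ k : ℕ, A k → List (A 0)
  | 0, a => [a]
  | (k+1), a => (τ k a).flatMap (word0 τ k)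

/-- The directive sequence is primitive. -/
def PrimitiveSeq {A : ℕ → Type*} (τ : ∀ n, A (n+1) → List (A n)) : Prop :=
  ∀ n, ∃ k : ℕ, 0 < k ∧ ∀ (a : A (n+k)) (b : A n), b ∈ sadicWordAux τ n k a

/-- The `n`-th level `X_τ^{(n)}` of the S-adic system generated by `τ`. -/
def XLevel {A : ℕ → Type*} (τ : ∀ n, A (n+1) → List (A n)) (n : ℕ) :
    Set (ℤ → A n) :=
  {y | ∀ (i : ℤ) (m : ℕ), ∃ k : ℕ, 0 < k ∧ ∃ a : A (n+k),
      (factorAt y i m).IsInfix (sadicWordAux τ n k a)}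

/-- The alphabet rank (`liminf_n |A_n|`) is at most `K`. -/
def AlphabetRankLE (A : ℕ → Type*) [∀ n, Fintype (A n)] (K : ℕ) : Prop :=
  ∀ N : ℕ, ∃ n, N ≤ n ∧ Fintype.card (A n) ≤ K

/-! ### Recognizability -/

/-- `z` is the bi-infinite concatenation `⋯σ(y(-1)).σ(y(0))σ(y(1))⋯`,
with `σ(y(0))` starting at coordinate `0`. -/
def IsConcat (σ : B → List C) (y : ℤ → B) (z : ℤ → C) : Prop :=
  ∃ c : ℤ → ℤ, c 0 = 0 ∧ (∀ j : ℤ, c (j + 1) = c j + (σ (y j)).length) ∧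
    ∀ (j : ℤ) (m : Fin (σ (y j)).length), z (c j + (m : ℕ)) = (σ (y j)).get m

/-- `(y, k)` is a centered `σ`-representation of `x` in `Y`. -/
def IsCenteredRep (σ : B → List C) (Y : Set (ℤ → B)) (x : ℤ → C)
    (y : ℤ → B) (k : ℕ) : Prop :=
  y ∈ Y ∧ k < (σ (y 0)).length ∧ IsConcat σ y (fun m => x (m - k))

/-- The morphism `σ` is recognizable in `Y`. -/
def RecognizableIn (σ : B → List C) (Y : Set (ℤ → B)) : Prop :=
  ∀ (x : ℤ → C) (y y' : ℤ → B) (k k' : ℕ),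
    IsCenteredRep σ Y x y k → IsCenteredRep σ Y x y' k' → y = y' ∧ k = k'

/-- The directive sequence `τ` is recognizable. -/
def RecognizableSeq {A : ℕ → Type*} (τ : ∀ n, A (n+1) → List (A n)) : Prop :=
  ∀ n, RecognizableIn (τ n) (XLevel τ (n+1))

/-! ### Conjugacy -/

/-- `(X, TX)` and `(Y, TY)` are conjugate via a homeomorphism. -/
def ConjugateBy [TopologicalSpace A] [TopologicalSpace B]
    (X : Set (ℤ → A)) (Y : Set (ℤ → B))
    (TX : (ℤ → A) → (ℤ → A)) (TY : (ℤ → B) → (ℤ → B)) : Prop :=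
  ∃ φ : ↥X ≃ₜ ↥Y, ∀ (x : ℤ → A) (hx : x ∈ X) (hx' : TX x ∈ X),
    (φ ⟨TX x, hx'⟩).1 = TY (φ ⟨x, hx⟩).1

/-- `(X, S)` and `(Y, S)` are conjugate subshifts. -/
def Conjugate [TopologicalSpace A] [TopologicalSpace B]
    (X : Set (ℤ → A)) (Y : Set (ℤ → B)) : Prop :=
  ConjugateBy X Y shift shift

/-- `X` is a strong Toeplitz subshift of rank `K`: it is conjugate to the S-adic subshift
of a constant-length, primitive, proper and recognizable directive sequence of
alphabet rank at most `K`. -/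
def IsStrongToeplitzOfRank [TopologicalSpace A] (X : Set (ℤ → A)) (K : ℕ) : Prop :=
  ∃ (B : ℕ → Type) (iB : ∀ n, Fintype (B n)) (σ : ∀ n, B (n+1) → List (B n)),
    NonErasing σ ∧ ConstantLength σ ∧ PrimitiveSeq σ ∧ ProperSeq σ ∧
    RecognizableSeq σ ∧ @AlphabetRankLE B iB K ∧
    @Conjugate A (B 0) _ ⊥ X (XLevel σ 0)

/-- `X` is conjugate to the S-adic subshift of a primitive, proper and recognizable
directive sequence of alphabet rank at most `K`. -/
def HasFiniteRankSAdicRep [TopologicalSpace A] (X : Set (ℤ → A)) (K : ℕ) : Prop :=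
  ∃ (B : ℕ → Type) (iB : ∀ n, Fintype (B n)) (σ : ∀ n, B (n+1) → List (B n)),
    NonErasing σ ∧ PrimitiveSeq σ ∧ ProperSeq σ ∧
    RecognizableSeq σ ∧ @AlphabetRankLE B iB K ∧
    @Conjugate A (B 0) _ ⊥ X (XLevel σ 0)

/-! ### Cuts, languages, built-from -/

/-- The set of words `{x[t+kp, t+(k+1)p) : k ∈ ℤ}`. -/
def cutWords (x : ℤ → A) (p t : ℕ) : Set (List A) :=
  {w | ∃ k : ℤ, w = factorAt x ((t : ℤ) + k * p) p}

/-- `(p, t)` is a strong rank-2 cut of `x`. -/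
def StrongRank2Cut (x : ℤ → A) (p t : ℕ) : Prop :=
  t < p ∧ ∃ u v : List A, u ≠ v ∧ cutWords x p t = {u, v}

/-- The language `L_n(X)`. -/
def Lang (n : ℕ) (X : Set (ℤ → A)) : Set (List A) :=
  {w | ∃ x ∈ X, ∃ i : ℤ, w = factorAt x i n}

/-- The maximal common prefix of `u` and `v` has length greater than `m`. -/
def CommonPrefixLongerThan (u v : List A) (m : ℕ) : Prop :=
  m + 1 ≤ u.length ∧ m + 1 ≤ v.length ∧ u.take (m+1) = v.take (m+1)

/-- The maximal common suffix of `u` and `v` has length greater than `m`. -/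
def CommonSuffixLongerThan (u v : List A) (m : ℕ) : Prop :=
  CommonPrefixLongerThan u.reverse v.reverse m

/-- `b = (β₀, (α₁, …, α_k), β₁)` is a building of the word `w` from `W`:
`w = β₀α₁⋯α_kβ₁`, all `αᵢ ∈ W`, `β₀` is a proper suffix of an element of `W`,
and `β₁` is a proper prefix of an element of `W`. -/
def IsBuilding (W : Set (List A)) (w : List A)
    (b : List A × List (List A) × List A) : Prop :=
  w = b.1 ++ b.2.1.flatten ++ b.2.2 ∧ (∀ α ∈ b.2.1, α ∈ W) ∧
  (∃ u ∈ W, b.1 <:+ u ∧ b.1 ≠ u) ∧ (∃ u ∈ W, b.2.2 <+: u ∧ b.2.2 ≠ u)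

/-- `w` is uniquely built from `W`. -/
def UniquelyBuiltFrom (W : Set (List A)) (w : List A) : Prop :=
  ∃! b : List A × List (List A) × List A, IsBuilding W w b

/-- `X` together with one of its points satisfies the strong rank-2 cut property. -/
def GoodCuts [TopologicalSpace A] (X : Set (ℤ → A)) (x : ℤ → A) : Prop :=
  ∀ p : ℕ, 0 < p → DividesScale X p → ∀ m : ℕ,
    ∃ q t : ℕ, StrongRank2Cut x q t ∧ p ∣ q ∧ DividesScale X q ∧
      ∃ u v : List A, u ≠ v ∧ cutWords x q t = {u, v} ∧
        CommonPrefixLongerThan u v m ∧ CommonSuffixLongerThan u v m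

/-! ### Euclidean pairs and buildings of bi-infinite sequences -/

/-- `{u, v}` is a Euclidean pair. -/
def EuclideanPair (u v : List A) : Prop :=
  ∃ (w : List A) (k l : ℕ),
    u = (List.replicate k w).flatten ∧ v = (List.replicate l w).flatten

/-- `α` is the distinguished prefix of `u` and `v`. -/
def IsDistinguishedPrefix (u v α : List A) : Prop :=
  α.length < u.length + v.length ∧
  ∀ x y : List A,
    (∃ l : List (List A), (∀ w ∈ l, w = u ∨ w = v) ∧ x = u ++ l.flatten) →
    (∃ l : List (List A), (∀ w ∈ l, w = u ∨ w = v) ∧ y = v ++ l.flatten) →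
    α.length + 1 ≤ x.length → α.length + 1 ≤ y.length →
    α <+: x ∧ α <+: y ∧ x[α.length]? ≠ y[α.length]?

/-- `β` is the distinguished suffix of `u` and `v`. -/
def IsDistinguishedSuffix (u v β : List A) : Prop :=
  IsDistinguishedPrefix u.reverse v.reverse β.reverse

/-- `(c, f)` is a building of the bi-infinite sequence `x` from `W`:
block `j` starts at position `c j` and carries the word `f j ∈ W`. -/
def IsBuildingSeq (W : Set (List A)) (x : ℤ → A) (c : ℤ → ℤ) (f : ℤ → List A) : Prop :=
  (∀ j : ℤ, f j ∈ W) ∧ (∀ j : ℤ, c (j + 1) = c j + (f j).length) ∧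
  ∀ (j : ℤ) (m : Fin (f j).length), x (c j + (m : ℕ)) = (f j).get m

/-- The subshift `X_{u,v}` of all sequences built from `{u, v}`. -/
def Xuv (u v : List A) : Set (ℤ → A) :=
  {x | ∃ (c : ℤ → ℤ) (f : ℤ → List A), IsBuildingSeq {u, v} x c f}

/-! ### Block-code conjugacies -/

/-- A conjugacy `φ : X → Y` admitting block width `2n+1`. -/
structure BlockConjugacy (A : Type*) (X Y : Set (ℤ → A)) (n : ℕ) where
  toFun : (ℤ → A) → (ℤ → A)
  invFun : (ℤ → A) → (ℤ → A)
  maps_to : ∀ x ∈ X, toFun x ∈ Y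
  maps_from : ∀ y ∈ Y, invFun y ∈ X
  left_inv : ∀ x ∈ X, invFun (toFun x) = x
  right_inv : ∀ y ∈ Y, toFun (invFun y) = y
  shift_comm : ∀ x ∈ X, toFun (shift x) = shift (toFun x)
  code : List A → A
  code_inv : List A → A
  code_spec : ∀ x ∈ X, ∀ i : ℤ, toFun x i = code (factorAt x (i - n) (2*n+1))
  code_inv_spec : ∀ y ∈ Y, ∀ i : ℤ, invFun y i = code_inv (factorAt y (i - n) (2*n+1))

/-! ### Parts, permutation action, χ -/

/-- `W` is a member of `Parts(X, p)`: a class of the common-`p`-skeleton relation. -/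
def SkelClass (X : Set (ℤ → A)) (p : ℕ) (W : Set (ℤ → A)) : Prop :=
  ∃ y ∈ X, W = {z ∈ X | Skel z p = Skel y p}

/-- The map `ψ̂` induced by a permutation `ψ` of `A^p`. -/
def permHat (p : ℕ) (ψ : Equiv.Perm (Fin p → A)) (x : ℤ → A) : ℤ → A :=
  fun i =>
    if h : (i.emod p).toNat < p then
      ψ (fun m : Fin p => x (i - i.emod p + (m : ℕ))) ⟨(i.emod p).toNat, h⟩
    else x i

/-- The relation `E_p` on compact subsets of `A^ℤ`. -/
def EpRel (p : ℕ) (K L : Set (ℤ → A)) : Prop :=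
  ∃ ψ : Equiv.Perm (Fin p → A), L = permHat p ψ '' K

/-- `W ∈ Parts_*(X, p)`. -/
def SkelClassStar (X : Set (ℤ → A)) (p : ℕ) (W : Set (ℤ → A)) : Prop :=
  SkelClass X p W ∧ ∀ y ∈ W, Skel y p (-1) = none ∧ Skel y p 0 ≠ none

/-- `length(W) = L` for `W ∈ Parts_*(X, p)`. -/
def HasLength (p : ℕ) (W : Set (ℤ → A)) (L : ℕ) : Prop :=
  ∀ y ∈ W, (∀ i : ℕ, i < L → Skel y p (i : ℤ) ≠ none) ∧ Skel y p (L : ℤ) = none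

/-- `Z ∈ χ(X, p)`. -/
def ChiMem (X : Set (ℤ → A)) (p : ℕ) (Z : Set (ℤ → A)) : Prop :=
  ∃ (W : Set (ℤ → A)) (L : ℕ), SkelClassStar X p W ∧ HasLength p W L ∧
    (∀ (W' : Set (ℤ → A)) (L' : ℕ),
      SkelClassStar X p W' → HasLength p W' L' → L' ≤ L) ∧
    Z = shiftBy ((L / 2 : ℕ) : ℤ) '' W

/-- `χ(X, p) E_p^fin χ(Y, p)`. -/
def ChiEpFin (X Y : Set (ℤ → A)) (p : ℕ) : Prop :=
  (∀ K, ChiMem X p K → ∃ L, ChiMem Y p L ∧ EpRel p K L) ∧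
  (∀ L, ChiMem Y p L → ∃ K, ChiMem X p K ∧ EpRel p K L)

/-! ### Single holes and fillings -/

/-- The Toeplitz sequence `x` has single holes with respect to the period structure `P`. -/
def SingleHoles (x : ℤ → A) (P : ℕ → ℕ) : Prop :=
  IsPeriodStructure x P ∧
  ∀ n, ∃! i : ℤ, 0 ≤ i ∧ i < (P n : ℤ) ∧ i ∉ PerSet x (P n)

/-- The Toeplitz subshift `X` has single holes. -/
def HasSingleHoles [TopologicalSpace A] (X : Set (ℤ → A)) : Prop :=
  ∃ (x : ℤ → A) (P : ℕ → ℕ), ToeplitzGenerates x X ∧ SingleHoles x P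

/-- `w` is the `(n, m)`-filling of `x` (for periods `pn < pm`). -/
def IsFilling (x : ℤ → A) (pn pm : ℕ) (w : List A) : Prop :=
  w.length = pm / pn - 1 ∧
  ∀ h : ℤ, 0 ≤ h → h < (pm : ℤ) → h ∉ PerSet x pm →
    ∀ (j : ℕ) (hj : j < w.length), w.get ⟨j, hj⟩ = x (h + (j+1) * pn)

/-- `u` is a `θ`-palindrome. -/
def ThetaPalindrome (θ : Equiv.Perm A) (u : List A) : Prop :=
  u.map (fun a => θ a) = u.reverse

/-! ### Nice symmetries -/

/-- `x` has nice symmetries with respect to `(p, q)`. -/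
def NiceSymmetries (x : ℤ → A) (p q : ℕ) : Prop :=
  ∃ m : ℤ, 1 < m ∧ m ≤ (q : ℤ) + 1 ∧
    (∀ k : ℕ, k < q / p →
      (Set.Ico ((k * p : ℕ) : ℤ) (((k+1) * p : ℕ) : ℤ) ⊆ PerSet x q ↔
       Set.Ico (m - ((k+1) * p : ℕ)) (m - (k * p : ℕ)) ⊆ PerSet x q)) ∧
    (∀ k k' : ℕ, k < q / p → k' < q / p →
      Set.Ico ((k * p : ℕ) : ℤ) (((k+1) * p : ℕ) : ℤ) ⊆ PerSet x q →
      Set.Ico ((k' * p : ℕ) : ℤ) (((k'+1) * p : ℕ) : ℤ) ⊆ PerSet x q →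
      (factorAt x ((k * p : ℕ) : ℤ) p = factorAt x ((k' * p : ℕ) : ℤ) p ↔
       factorAt x (m - ((k+1) * p : ℕ)) p = factorAt x (m - ((k'+1) * p : ℕ)) p))

/-- For some `p` dividing the scale of `X`, `x` has nice symmetries with respect to
`(p, q)` for all `q > p` with `p ∣ q` dividing the scale of `X`. -/
def NiceSymAll [TopologicalSpace A] (X : Set (ℤ → A)) (x : ℤ → A) : Prop :=
  ∃ p : ℕ, 0 < p ∧ DividesScale X p ∧
    ∀ q : ℕ, p < q → p ∣ q → DividesScale X q → NiceSymmetries x p q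

/-- A pair `(x, x')` is a centered left asymptotic pair. -/
def CenteredLeftAsymptoticPair (x x' : ℤ → A) : Prop :=
  (∀ i : ℤ, i < 0 → x i = x' i) ∧ x 0 ≠ x' 0

/-! ### Automorphism groups -/

/-- `e` is an automorphism of the subshift `(X, S)`. -/
def IsShiftAutomorphism [TopologicalSpace A] (X : Set (ℤ → A)) (e : ↥X ≃ₜ ↥X) : Prop :=
  ∀ (x : ℤ → A) (hx : x ∈ X) (hx' : shift x ∈ X),
    (e ⟨shift x, hx'⟩).1 = shift (e ⟨x, hx⟩).1

/-- The automorphism group of `(X, S)` is isomorphic, as a group, to `ℤ × ℤ/nℤ`. -/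
def AutGroupIsoZxZmod [TopologicalSpace A] (X : Set (ℤ → A)) (n : ℕ) : Prop :=
  ∃ Φ : {e : ↥X ≃ₜ ↥X // IsShiftAutomorphism X e} → ℤ × ZMod n,
    Function.Bijective Φ ∧
    ∀ e f g : {e : ↥X ≃ₜ ↥X // IsShiftAutomorphism X e},
      (∀ z : ↥X, g.1 z = e.1 (f.1 z)) → Φ g = Φ e + Φ f

/-! ### The Polish space of subshifts over `ℤ` -/

/-- A point of the space `𝐒` of all (compact, nonempty, shift-invariant) subshifts
over finite alphabets contained in `ℤ`. -/
structure SubshiftSpace : Type where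
  carrier : Set (ℤ → ℤ)
  nonempty : carrier.Nonempty
  compact : IsCompact carrier
  invariant : shift '' carrier = carrier

/-- The topology on `𝐒` induced by the languages `(L_n(X))_{n}`, with each
family of `n`-languages discrete; this coincides with the metric
`d(X,Y) = 2^{-min{n : L_n(X) ≠ L_n(Y)}}`. -/
instance : TopologicalSpace SubshiftSpace :=
  TopologicalSpace.induced
    (fun X : SubshiftSpace => (fun n => Lang n X.carrier : ℕ → Set (List ℤ)))
    (@Pi.topologicalSpace ℕ (fun _ => Set (List ℤ)) (fun _ => ⊥))

/-- The subset `𝐌 ⊆ 𝐒` of infinite minimal subshifts. -/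
def MinimalSet : Set SubshiftSpace :=
  {X | X.carrier.Infinite ∧ ∀ x ∈ X.carrier, X.carrier ⊆ closure (orbit x)}


/-! ### Basic facts -/

lemma shiftBy_shiftBy (a b : ℤ) (x : ℤ → A) : shiftBy a (shiftBy b x) = shiftBy (a + b) x := by
  funext i; simp [shiftBy, add_assoc]

lemma shiftBy_zero (x : ℤ → A) : shiftBy 0 x = x := by
  funext i; simp [shiftBy]

lemma shift_eq_shiftBy (x : ℤ → A) : shift x = shiftBy 1 x := rfl

lemma continuous_shiftBy [TopologicalSpace A] (k : ℤ) :
    Continuous (shiftBy k : (ℤ → A) → (ℤ → A)) := by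
  unfold shiftBy
  fun_prop

lemma factorAt_eq_map (x : ℤ → A) (i : ℤ) (n : ℕ) :
    factorAt x i n = (List.range n).map (fun j : ℕ => x (i + (j : ℤ))) := by
  simp only [factorAt, List.bind_eq_flatMap, List.map_flatMap, List.pure_def, List.map_cons,
    List.map_nil]
  exact (List.map_eq_flatMap).symm

lemma factorAt_eq_iff (x y : ℤ → A) (i j : ℤ) (n : ℕ) :
    factorAt x i n = factorAt y j n ↔ ∀ k : ℕ, k < n → x (i + k) = y (j + k) := by
  simp [factorAt_eq_map]

/-- Shift invariance under all powers. -/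
def Inv (X : Set (ℤ → ℤ)) : Prop := ∀ (k : ℤ), ∀ x ∈ X, shiftBy k x ∈ X

lemma inv_of_image {X : Set (ℤ → ℤ)} (h : shift '' X = X) : Inv X := by
  have h1 : ∀ x ∈ X, shiftBy 1 x ∈ X := by
    intro x hx
    rw [← h]
    exact ⟨x, hx, rfl⟩
  have h2 : ∀ x ∈ X, shiftBy (-1) x ∈ X := by
    intro x hx
    rw [← h] at hx
    obtain ⟨y, hy, rfl⟩ := hx
    rw [shift_eq_shiftBy, shiftBy_shiftBy]
    simpa [shiftBy_zero] using hy
  intro k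
  induction k using Int.induction_on with
  | zero => intro x hx; rwa [shiftBy_zero]
  | succ i ih =>
    intro x hx
    have := h1 _ (ih x hx)
    rwa [shiftBy_shiftBy, add_comm] at this
  | pred i ih =>
    intro x hx
    have := h2 _ (ih x hx)
    rw [shiftBy_shiftBy] at this
    convert this using 2
    ring

lemma image_of_inv {X : Set (ℤ → ℤ)} (h : Inv X) : shift '' X = X := by
  ext x
  constructor
  · rintro ⟨y, hy, rfl⟩
    exact h 1 y hy
  · intro hx
    refine ⟨shiftBy (-1) x, h _ _ hx, ?_⟩
    rw [shift_eq_shiftBy, shiftBy_shiftBy]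
    simp [shiftBy_zero]

lemma window_lemma {K U : Set (ℤ → ℤ)} (hK : IsCompact K) (hU : IsOpen U) (h : K ⊆ U) :
    ∃ n : ℕ, ∀ x ∈ K, ∀ y : ℤ → ℤ, (∀ i : ℤ, |i| ≤ n → x i = y i) → y ∈ U := by
  have key : ∀ x ∈ K, ∃ n : ℕ, ∀ y : ℤ → ℤ, (∀ i : ℤ, |i| ≤ n → x i = y i) → y ∈ U := by
    intro x hx
    obtain ⟨I, u, hu, hsub⟩ := isOpen_pi_iff.1 hU x (h hx)
    refine ⟨I.sup (fun i => i.natAbs), fun y hy => hsub ?_⟩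
    intro i hi
    have : i.natAbs ≤ I.sup (fun i => i.natAbs) := Finset.le_sup (f := fun i : ℤ => i.natAbs) hi
    rw [← hy i (by rw [Int.abs_eq_natAbs]; exact_mod_cast this)]
    exact (hu i hi).2
  choose! N hN using key
  obtain ⟨t, ht, hcov⟩ := hK.elim_nhds_subcover
    (fun x => {y | ∀ i ∈ Set.Icc (-(N x : ℤ)) (N x), y i = x i}) (by
      intro x hx
      have : {y : ℤ → ℤ | ∀ i ∈ Set.Icc (-(N x : ℤ)) (N x), y i = x i}
          = Set.pi (Set.Icc (-(N x : ℤ)) (N x)) (fun i => {x i}) := by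
        ext y; simp [Set.mem_pi]
      rw [this]
      exact set_pi_mem_nhds (Set.finite_Icc _ _) (fun i _ => by simp))
  refine ⟨t.sup N, fun x hx y hy => ?_⟩
  obtain ⟨z, hz, hxz⟩ := Set.mem_iUnion₂.1 (hcov hx)
  have hle : N z ≤ t.sup N := Finset.le_sup hz
  refine hN z (ht z hz) y (fun i hi => ?_)
  rw [abs_le] at hi
  rw [← hy i (by rw [abs_le]; omega)]
  exact (hxz i ⟨hi.1, hi.2⟩).symm

lemma isOpen_lang_eq (n : ℕ) (L : Set (List ℤ)) :
    IsOpen {X : SubshiftSpace | Lang n X.carrier = L} := by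
  let _ : TopologicalSpace (Set (List ℤ)) := ⊥
  have : Continuous (fun X : SubshiftSpace => (fun n => Lang n X.carrier : ℕ → Set (List ℤ))) :=
    continuous_induced_dom
  have h2 := (continuous_apply n).comp this
  have h3 : @IsOpen _ (⊥ : TopologicalSpace (Set (List ℤ))) {L} := trivial
  exact h3.preimage h2

lemma isOpen_subset {U : Set (ℤ → ℤ)} (hU : IsOpen U) :
    IsOpen {X : SubshiftSpace | X.carrier ⊆ U} := by
  rw [isOpen_iff_forall_mem_open]
  intro X hX
  obtain ⟨n, hn⟩ := window_lemma X.compact hU hX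
  refine ⟨_, ?_, isOpen_lang_eq (2 * n + 1) (Lang (2 * n + 1) X.carrier), rfl⟩
  intro Y hY y hy
  have : factorAt y (-n) (2 * n + 1) ∈ Lang (2 * n + 1) X.carrier := by
    rw [← show _ = _ from hY]
    exact ⟨y, hy, _, rfl⟩
  obtain ⟨x, hx, i, hi⟩ := this
  rw [factorAt_eq_iff] at hi
  refine hn (shiftBy (i + n) x) (inv_of_image X.invariant _ _ hx) y (fun j hj => ?_)
  rw [abs_le] at hj
  have := hi (j + n).toNat (by omega)
  rw [show (-(n:ℤ) + ((j + n).toNat : ℤ)) = j by omega] at this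
  rw [this]
  simp only [shiftBy]
  congr 1
  omega

lemma open_nbhd {V : Set SubshiftSpace} (hV : IsOpen V) {Y : SubshiftSpace} (hY : Y ∈ V) :
    ∃ N : ℕ, ∀ X : SubshiftSpace, (∀ n ≤ N, Lang n X.carrier = Lang n Y.carrier) → X ∈ V := by
  let _ : TopologicalSpace (Set (List ℤ)) := ⊥
  obtain ⟨t, ht, rfl⟩ := isOpen_induced_iff.1 hV
  obtain ⟨I, u, hu, hsub⟩ := isOpen_pi_iff.1 ht _ hY
  refine ⟨I.sup id, fun X hX => hsub ?_⟩
  intro i hi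
  have : i ≤ I.sup id := Finset.le_sup (f := id) hi
  show Lang i X.carrier ∈ u i
  rw [hX i this]
  exact (hu i hi).2

/-! ### The generic condition -/

/-- The local condition on points. -/
def Tset (m p : ℕ) (E F : Set (ℤ → ℤ)) (f g h : ℤ → ℤ) : Set (ℤ → ℤ) :=
  {x | (∃ r : ℕ, r < p ∧ shiftBy r x ∈ E) ∧
    (x ∈ F ∨ (x ∈ E ∧ (∀ r : ℕ, r < p → 0 < r → shiftBy r x ∈ F) ∧ shiftBy p x ∈ E ∧
      ((∀ i : ℕ, i < p → x i = f i) ∨ (∀ i : ℕ, i < p → x i = g i)) ∧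
      (∀ i ∈ Finset.Ico (-(m : ℤ)) m, x i = h i)))}

/-- The generic property of level `m`. -/
def Good (m : ℕ) (X : Set (ℤ → ℤ)) : Prop :=
  ∃ (p : ℕ) (E F : Set (ℤ → ℤ)) (f g h : ℤ → ℤ), IsOpen E ∧ IsOpen F ∧ Disjoint E F ∧
    m < p ∧ (∀ q : ℕ, 0 < q → q ≤ m → q ∣ p) ∧ X ⊆ Tset m p E F f g h

lemma isOpen_coord (i a : ℤ) : IsOpen {x : ℤ → ℤ | x i = a} :=
  (isOpen_discrete ({a} : Set ℤ)).preimage (continuous_apply (A := fun _ : ℤ => ℤ) i)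

lemma isOpen_Tset (m p : ℕ) {E F : Set (ℤ → ℤ)} (f g h : ℤ → ℤ) (hE : IsOpen E)
    (hF : IsOpen F) : IsOpen (Tset m p E F f g h) := by
  have hall : ∀ f : ℤ → ℤ, IsOpen {x : ℤ → ℤ | ∀ i : ℕ, i < p → x i = f i} := by
    intro f
    have := isOpen_biInter_finset (s := Finset.range p)
      (f := fun i : ℕ => {x : ℤ → ℤ | x i = f i}) (fun i _ => isOpen_coord i _)
    convert this using 1
    ext x; simp
  have hm : IsOpen {x : ℤ → ℤ | ∀ i ∈ Finset.Ico (-(m : ℤ)) m, x i = h i} := by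
    have := isOpen_biInter_finset (s := Finset.Ico (-(m : ℤ)) m)
      (f := fun i : ℤ => {x : ℤ → ℤ | x i = h i}) (fun i _ => isOpen_coord i _)
    convert this using 1
    ext x; simp
  have h1 : IsOpen {x : ℤ → ℤ | ∃ r : ℕ, r < p ∧ shiftBy r x ∈ E} := by
    have := isOpen_biUnion (s := {r : ℕ | r < p})
      (f := fun r : ℕ => shiftBy (r : ℤ) ⁻¹' E) (fun i _ => hE.preimage (continuous_shiftBy _))
    convert this using 1
    ext x; simp
  have h2 : IsOpen {x : ℤ → ℤ | ∀ r : ℕ, r < p → 0 < r → shiftBy r x ∈ F} := by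
    have := isOpen_biInter_finset (s := (Finset.range p).filter (fun r => 0 < r))
      (f := fun r : ℕ => shiftBy (r : ℤ) ⁻¹' F) (fun i _ => hF.preimage (continuous_shiftBy _))
    convert this using 1
    ext x; simp
  have h3 : IsOpen {x : ℤ → ℤ | shiftBy p x ∈ E} := hE.preimage (continuous_shiftBy _)
  exact h1.inter (hF.union (hE.inter (h2.inter (h3.inter (((hall f).union (hall g)).inter hm)))))

lemma isOpen_good (m : ℕ) : IsOpen {X : SubshiftSpace | Good m X.carrier} := by
  rw [isOpen_iff_forall_mem_open]
  rintro X ⟨p, E, F, f, g, h, hE, hF, hd, hp, hq, hX⟩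
  exact ⟨_, fun Y hY => ⟨p, E, F, f, g, h, hE, hF, hd, hp, hq, hY⟩,
    isOpen_subset (isOpen_Tset m p f g h hE hF), hX⟩

/-! ### Minimality -/

/-- Minimality of a set. -/
def Mini (X : Set (ℤ → ℤ)) : Prop := ∀ x ∈ X, X ⊆ closure (orbit x)

lemma syndetic {X U : Set (ℤ → ℤ)} (hc : IsCompact X) (hi : Inv X) (hm : Mini X)
    (hU : IsOpen U) (hne : (X ∩ U).Nonempty) :
    ∃ M : ℕ, ∀ x ∈ X, ∃ j : ℕ, j < M ∧ shiftBy j x ∈ U := by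
  have h1 : X ⊆ ⋃ k : ℤ, shiftBy k ⁻¹' U := by
    intro x hx
    obtain ⟨z, hz, hzU⟩ := hne
    obtain ⟨y, hy, k, rfl⟩ := mem_closure_iff.1 (hm x hx hz) U hU hzU
    exact mem_iUnion.2 ⟨k, hy⟩
  obtain ⟨t, ht⟩ := hc.elim_finite_subcover _ (fun k => hU.preimage (continuous_shiftBy k)) h1
  let K : ℕ := t.sup (fun i => i.natAbs)
  refine ⟨2 * K + 1, fun x hx => ?_⟩
  obtain ⟨k, hk, hkU⟩ := mem_iUnion₂.1 (ht (hi K x hx))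
  have : k.natAbs ≤ K := Finset.le_sup (f := fun i : ℤ => i.natAbs) hk
  refine ⟨(k + K).toNat, by omega, ?_⟩
  rw [mem_preimage, shiftBy_shiftBy] at hkU
  rwa [Int.toNat_of_nonneg (by omega)]

/-- An infinite minimal set contains no periodic point. -/
lemma no_periodic {X : Set (ℤ → ℤ)} (hinf : X.Infinite) (hm : Mini X) {x : ℤ → ℤ} (hx : x ∈ X)
    {p : ℤ} (hp : 0 < p) (hper : ∀ i, x (i + p) = x i) : False := by
  have hfin : (orbit x).Finite := by
    refine ((Set.finite_Ico (0 : ℤ) p).image (fun k => shiftBy k x)).subset ?_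
    rintro y ⟨k, rfl⟩
    refine ⟨k % p, ⟨Int.emod_nonneg _ hp.ne', Int.emod_lt_of_pos _ hp⟩, ?_⟩
    have hmul : ∀ (q : ℤ) i, x (i + q * p) = x i := by
      intro q
      induction q using Int.induction_on with
      | zero => simp
      | succ n ih => intro i; rw [add_mul, one_mul, ← add_assoc, hper, ih]
      | pred n ih =>
        intro i
        rw [← hper, ← ih i]
        congr 1; ring
    funext i
    show x (i + k % p) = x (i + k)
    rw [← hmul (k / p)]
    congr 1
    have := Int.emod_add_mul_ediv k p
    linarith [mul_comm p (k / p)]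
  exact hinf (hfin.subset ((hm x hx).trans hfin.isClosed.closure_subset))

/-! ### Cyclic clopen partitions -/

/-- A cyclic clopen partition of `X` with base `E` and period `p`. -/
structure Lev (X : Set (ℤ → ℤ)) where
  p : ℕ
  E : Set (ℤ → ℤ)
  pos : 0 < p
  sub : E ⊆ X
  closed : IsClosed E
  op : ∃ U : Set (ℤ → ℤ), IsOpen U ∧ E = X ∩ U
  cover : ∀ x ∈ X, ∃ r : ℕ, r < p ∧ shiftBy r x ∈ E
  uniq : ∀ x ∈ E, ∀ r : ℕ, r < p → 0 < r → shiftBy r x ∉ E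
  step : ∀ x ∈ E, shiftBy p x ∈ E

lemma Lev.mem_mul {X : Set (ℤ → ℤ)} (hi : Inv X) (L : Lev X) (k : ℤ) :
    ∀ x ∈ L.E, shiftBy (k * L.p) x ∈ L.E := by
  have hback : ∀ x ∈ L.E, shiftBy (-(L.p : ℤ)) x ∈ L.E := by
    intro x hx
    obtain ⟨r, hr, hr'⟩ := L.cover _ (hi (-(L.p : ℤ)) x (L.sub hx))
    have h1 := L.step _ hr'
    rw [shiftBy_shiftBy, shiftBy_shiftBy,
      show (L.p : ℤ) + r + -(L.p : ℤ) = r by ring] at h1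
    rcases Nat.eq_zero_or_pos r with h0 | h0
    · subst h0
      simpa [shiftBy_shiftBy] using hr'
    · exact absurd h1 (L.uniq x hx r hr h0)
  induction k using Int.induction_on with
  | zero => intro x hx; simpa [shiftBy_zero] using hx
  | succ n ih =>
    intro x hx
    have := L.step _ (ih x hx)
    rw [shiftBy_shiftBy] at this
    convert this using 2
    ring
  | pred n ih =>
    intro x hx
    have := hback _ (ih x hx)
    rw [shiftBy_shiftBy] at this
    convert this using 2
    ring

lemma Lev.mem_iff {X : Set (ℤ → ℤ)} (hi : Inv X) (L : Lev X) {x : ℤ → ℤ} (hx : x ∈ L.E) (k : ℤ) :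
    shiftBy k x ∈ L.E ↔ (L.p : ℤ) ∣ k := by
  have hp : (0 : ℤ) < L.p := by exact_mod_cast L.pos
  constructor
  · intro h
    have h1 := L.mem_mul hi (-(k / L.p)) _ h
    rw [shiftBy_shiftBy] at h1
    have e : -(k / (L.p : ℤ)) * L.p + k = ((k % L.p).toNat : ℤ) := by
      rw [Int.toNat_of_nonneg (Int.emod_nonneg _ hp.ne')]
      have := Int.emod_add_mul_ediv k L.p
      linarith [mul_comm (L.p : ℤ) (k / L.p)]
    rw [e] at h1
    by_contra hnd
    have h2 := Int.emod_nonneg k hp.ne'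
    have h3 := Int.emod_lt_of_pos k hp
    have h4 : k % L.p ≠ 0 := fun h => hnd (Int.dvd_of_emod_eq_zero h)
    exact L.uniq x hx _ (by omega) (by omega) h1
  · rintro ⟨c, rfl⟩
    rw [mul_comm]
    exact L.mem_mul hi c x hx

/-- The refinement relation between two levels. -/
def Ext {X : Set (ℤ → ℤ)} (L L' : Lev X) : Prop :=
  L'.E ⊆ L.E ∧ L.p ∣ L'.p ∧ L.p < L'.p ∧
  (∃ f g : ℤ → ℤ, ∀ x ∈ L'.E, (∀ i : ℕ, i < L'.p → x i = f i) ∨ (∀ i : ℕ, i < L'.p → x i = g i)) ∧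
  (∃ h : ℤ → ℤ, ∀ x ∈ L'.E, ∀ i : ℤ, -(L.p : ℤ) ≤ i → i < L.p → x i = h i)

lemma exists_ext {X : Set (ℤ → ℤ)} (hne : X.Nonempty) (hc : IsCompact X) (hi : Inv X)
    (hm : Mini X) (hG : ∀ m, Good m X) (L : Lev X) : ∃ L' : Lev X, Ext L L' := by
  obtain ⟨p', E, F, f, g, h, hE, hF, hd, hp', hq, hX⟩ := hG (2 * L.p)
  have hpos := L.pos
  obtain ⟨d, hd'⟩ := hq L.p hpos (by omega)
  have hdisj : ∀ x, x ∈ E → x ∈ F → False := fun x h1 h2 => Set.disjoint_left.1 hd h1 h2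
  have hcov : ∀ x ∈ X, ∃ r : ℕ, r < p' ∧ shiftBy r x ∈ E := fun x hx => (hX hx).1
  have hEF : ∀ x ∈ X, x ∉ E → x ∈ F := fun x hx hxE => by
    rcases (hX hx).2 with h1 | h1
    · exact h1
    · exact absurd h1.1 hxE
  have hprop : ∀ x ∈ X, x ∈ E → ((∀ r : ℕ, r < p' → 0 < r → shiftBy r x ∈ F) ∧ shiftBy p' x ∈ E ∧
      ((∀ i : ℕ, i < p' → x i = f i) ∨ (∀ i : ℕ, i < p' → x i = g i)) ∧
      (∀ i ∈ Finset.Ico (-((2 * L.p : ℕ) : ℤ)) (2 * L.p : ℕ), x i = h i)) := fun x hx hxE => by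
    rcases (hX hx).2 with h1 | h1
    · exact absurd h1 (fun h => hdisj x hxE h)
    · exact h1.2
  have hXE : X ∩ E = X ∩ Fᶜ := by
    ext x
    constructor
    · rintro ⟨h1, h2⟩; exact ⟨h1, fun h3 => hdisj x h2 h3⟩
    · rintro ⟨h1, h2⟩
      refine ⟨h1, ?_⟩
      by_contra h3
      exact h2 (hEF x h1 h3)
  have hEcl : IsClosed (X ∩ E) := by
    rw [hXE]; exact hc.isClosed.inter hF.isClosed_compl
  let L0 : Lev X :=
    { p := p', E := X ∩ E, pos := by omega, sub := inter_subset_left, closed := hEcl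
      op := ⟨E, hE, rfl⟩
      cover := fun x hx => by
        obtain ⟨r, hr, hr'⟩ := hcov x hx
        exact ⟨r, hr, hi _ _ hx, hr'⟩
      uniq := fun x hx r hr hr0 hmem => hdisj _ hmem.2 ((hprop x hx.1 hx.2).1 r hr hr0)
      step := fun x hx => ⟨hi _ _ hx.1, (hprop x hx.1 hx.2).2.1⟩ }
  have hEmul := L0.mem_mul hi
  -- a base point
  obtain ⟨x0, hx0⟩ : ∃ x0, x0 ∈ X ∩ E := by
    obtain ⟨x, hx⟩ := hne
    obtain ⟨r, _, hr⟩ := L0.cover x hx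
    exact ⟨_, hr⟩
  obtain ⟨r, hr, hrE⟩ := L.cover x0 hx0.1
  let E' : Set (ℤ → ℤ) := L.E ∩ shiftBy (-(r : ℤ)) ⁻¹' (X ∩ E)
  have hE'cl : IsClosed E' := L.closed.inter (hEcl.preimage (continuous_shiftBy _))
  have hcover' : ∀ x ∈ X, ∃ j : ℕ, j < p' ∧ shiftBy j x ∈ E' := by
    have hcl : IsClosed (⋃ j ∈ Finset.range p', shiftBy (j : ℤ) ⁻¹' E') := by
      refine isClosed_biUnion_finset (fun j _ => hE'cl.preimage (continuous_shiftBy _))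
    have horb : orbit x0 ⊆ ⋃ j ∈ Finset.range p', shiftBy (j : ℤ) ⁻¹' E' := by
      rintro _ ⟨k, rfl⟩
      have hp0 : (0 : ℤ) < p' := by omega
      have h2 := Int.emod_nonneg (r - k) hp0.ne'
      have h3 := Int.emod_lt_of_pos (r - k) hp0
      have h4 := Int.emod_add_mul_ediv (r - k) p'
      refine mem_iUnion₂.2 ⟨((r - k) % p').toNat, by simp; omega, ?_⟩
      rw [mem_preimage, shiftBy_shiftBy, Int.toNat_of_nonneg h2]
      have e : (r - k) % (p' : ℤ) + k = (-((r - k) / p')) * p' + r := by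
        linarith [mul_comm (p' : ℤ) ((r - k) / p')]
      rw [e]
      constructor
      · have := L.mem_mul hi ((-((r - k) / p')) * d) _ hrE
        rw [shiftBy_shiftBy] at this
        convert this using 3
        rw [hd']; push_cast; ring
      · have := hEmul (-((r - k) / p')) x0 hx0
        rw [mem_preimage, shiftBy_shiftBy]
        convert this using 2
        show _ = (-((r - k) / p')) * (p' : ℤ)
        ring
    intro x hx
    have := closure_minimal horb hcl (hm x0 hx0.1 hx)
    simpa using this
  obtain ⟨U, hU, hLU⟩ := L.op
  refine ⟨{ p := p', E := E', pos := by omega, sub := fun x hx => L.sub hx.1, closed := hE'cl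
            op := ⟨U ∩ shiftBy (-(r : ℤ)) ⁻¹' E, hU.inter (hE.preimage (continuous_shiftBy _)), ?_⟩
            cover := hcover'
            uniq := ?_
            step := ?_ }, fun x hx => hx.1, ⟨d, hd'⟩, by show L.p < p'; omega, ?_, ?_⟩
  · ext x
    constructor
    · rintro ⟨h1, h2⟩
      rw [hLU] at h1
      exact ⟨h1.1, h1.2, h2.2⟩
    · rintro ⟨h1, h2, h3⟩
      exact ⟨by rw [hLU]; exact ⟨h1, h2⟩, hi _ _ h1, h3⟩
  · rintro x ⟨h1, h2⟩ j hj hj0 ⟨h3, h4⟩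
    rw [mem_preimage, shiftBy_shiftBy, add_comm, ← shiftBy_shiftBy] at h4
    exact L0.uniq _ h2 j hj hj0 h4
  · rintro x ⟨h1, h2⟩
    refine ⟨?_, ?_⟩
    · have := L.mem_mul hi d _ h1
      rwa [show (d : ℤ) * L.p = p' by rw [hd']; push_cast; ring] at this
    · have := L0.step _ h2
      rw [shiftBy_shiftBy] at this
      rw [mem_preimage, shiftBy_shiftBy, add_comm]
      exact this
  · refine ⟨fun i => if i + r < p' then f (i + r) else h (i + r - p'),
      fun i => if i + r < p' then g (i + r) else h (i + r - p'), ?_⟩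
    rintro x ⟨h1, h2⟩
    have hval : ∀ i : ℤ, x i = shiftBy (-(r : ℤ)) x (i + r) := by
      intro i; simp [shiftBy]
    obtain ⟨ha, hb, hc', hd''⟩ := hprop _ h2.1 h2.2
    have hnext := (hprop _ (hi p' _ h2.1) hb).2.2.2
    have htail : ∀ i : ℕ, i < p' → ¬ ((i : ℤ) + r < p') → x i = h (i + r - p') := by
      intro i hi1 hi2
      rw [← hnext (i + r - p') (by simp; omega)]
      simp [shiftBy]
    rcases hc' with hc' | hc'
    · left
      intro i hi1
      show x i = if _ then _ else _
      split_ifs with hlt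
      · rw [hval, ← Nat.cast_add, hc' (i + r) (by omega)]
      · exact htail i hi1 hlt
    · right
      intro i hi1
      show x i = if _ then _ else _
      split_ifs with hlt
      · rw [hval, ← Nat.cast_add, hc' (i + r) (by omega)]
      · exact htail i hi1 hlt
  · refine ⟨fun i => h (i + r), ?_⟩
    rintro x ⟨h1, h2⟩ i hi1 hi2
    have := (hprop _ h2.1 h2.2).2.2.2 (i + r) (by simp; omega)
    simpa [shiftBy] using this

/-- The trivial level. -/
def Lev.triv {X : Set (ℤ → ℤ)} (hc : IsCompact X) (hi : Inv X) : Lev X where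
  p := 1
  E := X
  pos := one_pos
  sub := subset_rfl
  closed := hc.isClosed
  op := ⟨univ, isOpen_univ, by simp⟩
  cover := fun x hx => ⟨0, one_pos, hi _ _ hx⟩
  uniq := fun x hx r hr hr0 => by omega
  step := fun x hx => hi _ _ hx

lemma exists_tower {X : Set (ℤ → ℤ)} (hne : X.Nonempty) (hc : IsCompact X) (hi : Inv X)
    (hm : Mini X) (hG : ∀ m, Good m X) :
    ∃ T : ℕ → Lev X, (T 0).p = 1 ∧ (T 0).E = X ∧ ∀ n, Ext (T n) (T (n + 1)) := by
  choose nx hnx using exists_ext hne hc hi hm hG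
  exact ⟨fun n => Nat.rec (Lev.triv hc hi) (fun _ L => nx L) n, rfl, rfl, fun n => hnx _⟩

/-! ### Codings -/

section coding

variable {X : Set (ℤ → ℤ)}

/-- The first block of a point. -/
def Lev.rd (L : Lev X) (x : ℤ → ℤ) : Fin L.p → ℤ := fun i => x ((i : ℕ) : ℤ)

/-- The alphabet of blocks of level `L`. -/
def Lev.Bt (L : Lev X) : Type := {w : Fin L.p → ℤ // ∃ x ∈ L.E, L.rd x = w}

lemma Lev.nonemptyE (h : X.Nonempty) (L : Lev X) : L.E.Nonempty := by
  obtain ⟨x, hx⟩ := h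
  obtain ⟨r, _, hr⟩ := L.cover x hx
  exact ⟨_, hr⟩

instance Lev.nonemptyBt [h : Nonempty ↥X] (L : Lev X) : Nonempty L.Bt := by
  obtain ⟨x, hx⟩ := L.nonemptyE (Set.nonempty_coe_sort.1 h)
  exact ⟨⟨L.rd x, x, hx, rfl⟩⟩

open Classical in
/-- Turn a word into a letter of the alphabet. -/
noncomputable def Lev.toBt [Nonempty ↥X] (L : Lev X) (w : Fin L.p → ℤ) : L.Bt :=
  if h : ∃ x ∈ L.E, L.rd x = w then ⟨w, h⟩ else Classical.arbitrary _

/-- The letter of a point. -/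
noncomputable def Lev.cd [Nonempty ↥X] (L : Lev X) (x : ℤ → ℤ) : L.Bt := L.toBt (L.rd x)

/-- The coding of a point. -/
noncomputable def Lev.code [Nonempty ↥X] (L : Lev X) (x : ℤ → ℤ) : ℤ → L.Bt :=
  fun j => L.cd (shiftBy (j * L.p) x)

lemma Lev.emod_lt (L : Lev X) (i : ℤ) : (i % (L.p : ℤ)).toNat < L.p := by
  have h : (0 : ℤ) < L.p := by exact_mod_cast L.pos
  have h2 := Int.emod_nonneg i h.ne'
  have h3 := Int.emod_lt_of_pos i h
  omega

/-- Concatenate letters. -/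
def Lev.flat (L : Lev X) (y : ℤ → L.Bt) : ℤ → ℤ :=
  fun i => (y (i / L.p)).1 ⟨(i % L.p).toNat, L.emod_lt i⟩

lemma Lev.flat_val (L : Lev X) (y : ℤ → L.Bt) (n j : ℤ) (i : Fin L.p)
    (h : n = j * L.p + (i : ℕ)) : L.flat y n = (y j).1 i := by
  have hi := i.2
  have hp : (0 : ℤ) < L.p := by exact_mod_cast L.pos
  have h1 : n / L.p = j := by
    rw [h, add_comm, Int.add_mul_ediv_right _ _ hp.ne', Int.ediv_eq_zero_of_lt] <;> omega
  have h2 : n % L.p = (i : ℕ) := by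
    rw [h, add_comm, Int.add_mul_emod_self_right, Int.emod_eq_of_lt] <;> omega
  have h3 : (⟨(n % L.p).toNat, L.emod_lt n⟩ : Fin L.p) = i := by
    apply Fin.ext
    simp [h2]
  unfold Lev.flat
  rw [h3, h1]

variable [Nonempty ↥X]

lemma Lev.cd_val (L : Lev X) {x : ℤ → ℤ} (hx : x ∈ L.E) : (L.cd x).1 = L.rd x := by
  have : ∃ y ∈ L.E, L.rd y = L.rd x := ⟨x, hx, rfl⟩
  simp [Lev.cd, Lev.toBt, this]

lemma Lev.cd_surj (L : Lev X) (w : L.Bt) : ∃ x ∈ L.E, L.cd x = w := by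
  obtain ⟨w, x, hx, h⟩ := w
  refine ⟨x, hx, Subtype.ext ?_⟩
  exact (L.cd_val hx).trans h

lemma Lev.flat_code (hi : Inv X) (L : Lev X) {x : ℤ → ℤ} (hx : x ∈ L.E) :
    L.flat (L.code x) = x := by
  funext n
  have hp : (0 : ℤ) < L.p := by exact_mod_cast L.pos
  have h2 := Int.emod_nonneg n hp.ne'
  have h4 := Int.emod_add_mul_ediv n L.p
  rw [L.flat_val (L.code x) n (n / L.p) ⟨(n % L.p).toNat, L.emod_lt n⟩ (by
    simp only [Int.toNat_of_nonneg h2]; linarith [mul_comm (L.p : ℤ) (n / L.p)])]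
  unfold Lev.code
  rw [L.cd_val (L.mem_mul hi _ _ hx)]
  simp only [Lev.rd, shiftBy, Int.toNat_of_nonneg h2]
  congr 1
  linarith [mul_comm (L.p : ℤ) (n / L.p)]

lemma Lev.code_flat (hi : Inv X) (L : Lev X) {y : ℤ → L.Bt} (hy : L.flat y ∈ L.E) :
    L.code (L.flat y) = y := by
  funext j
  apply Subtype.ext
  unfold Lev.code
  rw [L.cd_val (L.mem_mul hi _ _ hy)]
  funext i
  simp only [Lev.rd, shiftBy]
  exact L.flat_val y _ j i (by ring)

lemma Lev.code_shift (L : Lev X) (x : ℤ → ℤ) (k : ℤ) :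
    L.code (shiftBy (k * L.p) x) = shiftBy k (L.code x) := by
  funext j
  simp only [Lev.code, shiftBy_shiftBy]
  show _ = L.cd (shiftBy ((j + k) * L.p) x)
  rw [add_mul]

lemma Lev.code_inj (hi : Inv X) (L : Lev X) {x x' : ℤ → ℤ} (hx : x ∈ L.E) (hx' : x' ∈ L.E)
    (h : L.code x = L.code x') : x = x' := by
  rw [← L.flat_code hi hx, h, L.flat_code hi hx']

/-- The morphism between two levels. -/
noncomputable def sig (L L' : Lev X) (w : L'.Bt) : List L.Bt :=
  factorAt (L.code (L'.cd_surj w).choose) 0 (L'.p / L.p)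

lemma sig_cd {L L' : Lev X} (hdvd : L.p ∣ L'.p)
    {x : ℤ → ℤ} (hx : x ∈ L'.E) :
    sig L L' (L'.cd x) = factorAt (L.code x) 0 (L'.p / L.p) := by
  unfold sig
  obtain ⟨hz, hzx⟩ := (L'.cd_surj (L'.cd x)).choose_spec
  generalize (L'.cd_surj (L'.cd x)).choose = z at hz hzx
  have h1 : L'.rd z = L'.rd x := by rw [← L'.cd_val hz, hzx, L'.cd_val hx]
  rw [factorAt_eq_iff]
  intro k hk
  unfold Lev.code Lev.cd
  congr 1
  funext i
  have hi := i.2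
  have hb : k * L.p + i < L'.p := by
    have : (k + 1) * L.p ≤ L'.p / L.p * L.p := Nat.mul_le_mul_right _ hk
    rw [Nat.div_mul_cancel hdvd] at this
    linarith [add_mul k 1 L.p]
  have h2 := congrFun h1 ⟨k * L.p + i, hb⟩
  simp only [Lev.rd] at h2
  simp only [Lev.rd, shiftBy]
  convert h2 using 2 <;> push_cast <;> ring

end coding

lemma factorAt_length (x : ℤ → A) (i : ℤ) (n : ℕ) : (factorAt x i n).length = n := by
  simp [factorAt_eq_map]

lemma factorAt_getElem (x : ℤ → A) (i : ℤ) (n k : ℕ) (h : k < (factorAt x i n).length) :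
    (factorAt x i n)[k] = x (i + k) := by
  simp [factorAt_eq_map]

lemma factorAt_shiftBy (x : ℤ → A) (i k : ℤ) (n : ℕ) :
    factorAt (shiftBy k x) i n = factorAt x (i + k) n := by
  rw [factorAt_eq_iff]
  intro j _
  simp only [shiftBy]
  congr 1; ring

lemma factorAt_add (x : ℤ → A) (i : ℤ) (m n : ℕ) :
    factorAt x i (m + n) = factorAt x i m ++ factorAt x (i + m) n := by
  simp [factorAt_eq_map, List.range_add, Function.comp_def, add_assoc]

lemma factorAt_flatMap (x : ℤ → A) (Q R : ℕ) :
    (List.range Q).flatMap (fun j : ℕ => factorAt x ((j : ℤ) * R) R) = factorAt x 0 (Q * R) := by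
  induction Q with
  | zero => simp [factorAt_eq_map]
  | succ Q ih =>
    rw [List.range_succ, List.flatMap_append, ih, add_mul, one_mul, factorAt_add]
    simp

lemma factorAt_infix (x : ℤ → A) (a m n : ℕ) (h : a + m ≤ n) :
    (factorAt x a m).IsInfix (factorAt x 0 n) := by
  obtain ⟨c, rfl⟩ := Nat.exists_eq_add_of_le h
  rw [factorAt_add, factorAt_add]
  exact ⟨factorAt x 0 a, factorAt x (0 + (a + m : ℕ)) c, by simp⟩

lemma infix_factorAt {x : ℤ → A} {n : ℕ} {w : List A} (h : w.IsInfix (factorAt x 0 n)) :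
    ∃ a : ℕ, a + w.length ≤ n ∧ w = factorAt x a w.length := by
  obtain ⟨s, t, hst⟩ := h
  have hlen : s.length + w.length + t.length = n := by
    rw [← factorAt_length x 0 n, ← hst]; simp [add_assoc]
  refine ⟨s.length, by omega, ?_⟩
  rw [← hlen, factorAt_add, factorAt_add] at hst
  have h1 := List.append_inj_left hst (by simp [factorAt_length])
  have h2 := List.append_inj_right h1 (by simp [factorAt_length])
  simpa using h2

section tower

variable {X : Set (ℤ → ℤ)} {T : ℕ → Lev X}

lemma tower_dvd (hT : ∀ n, Ext (T n) (T (n + 1))) (n k : ℕ) : (T n).p ∣ (T (n + k)).p := by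
  induction k with
  | zero => exact dvd_rfl
  | succ k ih => exact ih.trans (hT (n + k)).2.1

lemma tower_sub (hT : ∀ n, Ext (T n) (T (n + 1))) (n k : ℕ) : (T (n + k)).E ⊆ (T n).E := by
  induction k with
  | zero => exact subset_rfl
  | succ k ih => exact ((hT (n + k)).1).trans ih

lemma tower_large (hT : ∀ n, Ext (T n) (T (n + 1))) (n k : ℕ) : k < (T (n + k)).p := by
  induction k with
  | zero => exact (T (n + 0)).pos
  | succ k ih =>
    have := (hT (n + k)).2.2.1
    show k + 1 < (T (n + k + 1)).p
    omega

lemma finite_Bt (hc : IsCompact X) (L : Lev X) : Finite L.Bt := by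
  have h1 : IsCompact L.E := hc.of_isClosed_subset L.closed L.sub
  have h2 : Continuous L.rd := by unfold Lev.rd; fun_prop
  have h3 := (h1.image h2).finite_of_discrete
  exact (h3.subset (s := {w | ∃ x ∈ L.E, L.rd x = w}) (by rintro w ⟨x, hx, rfl⟩; exact ⟨x, hx, rfl⟩)).to_subtype

variable [Nonempty ↥X]

lemma sadic_cd (hi : Inv X) (hT : ∀ n, Ext (T n) (T (n + 1))) (n k : ℕ) :
    ∀ x ∈ (T (n + k)).E,
    sadicWordAux (A := fun n => (T n).Bt) (fun n => sig (T n) (T (n + 1))) n k ((T (n + k)).cd x)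
      = factorAt ((T n).code x) 0 ((T (n + k)).p / (T n).p) := by
  induction k with
  | zero =>
    intro x hx
    rw [show (T (n + 0)).p = (T n).p from rfl, Nat.div_self (T n).pos]
    simp only [sadicWordAux, factorAt_eq_map, Lev.code]
    simp [shiftBy_zero]
  | succ k ih =>
    intro x hx
    have hd1 := tower_dvd hT n k
    have hd2 := (hT (n + k)).2.1
    obtain ⟨R, hR⟩ := hd1
    obtain ⟨Q, hQ⟩ := hd2
    have hp := (T n).pos
    have hpk := (T (n + k)).pos
    have e1 : (T (n + (k + 1))).p / (T n).p = Q * R := by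
      rw [show (T (n + (k + 1))).p = (T (n + k + 1)).p from rfl, hQ, hR, mul_assoc,
        Nat.mul_div_cancel_left _ hp, mul_comm]
    have e2 : (T (n + k + 1)).p / (T (n + k)).p = Q := by
      rw [hQ, Nat.mul_div_cancel_left _ hpk]
    have e3 : (T (n + k)).p / (T n).p = R := by
      rw [hR, Nat.mul_div_cancel_left _ hp]
    rw [e1]
    show (sig (T (n + k)) (T (n + k + 1)) ((T (n + k + 1)).cd x)).flatMap _ = _
    rw [sig_cd (hT (n + k)).2.1 hx, e2, ← factorAt_flatMap, factorAt_eq_map, List.flatMap_map]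
    congr 1
    funext j
    have hxk : x ∈ (T (n + k)).E := (hT (n + k)).1 hx
    have := ih _ ((T (n + k)).mem_mul hi j x hxk)
    rw [e3] at this
    rw [show (T (n + k)).code x (0 + (j : ℤ)) = (T (n + k)).cd (shiftBy (j * (T (n + k)).p) x) by
      simp [Lev.code], this]
    rw [show (j : ℤ) * (T (n + k)).p = (j * R : ℤ) * (T n).p by rw [hR]; push_cast; ring,
      Lev.code_shift, factorAt_shiftBy]
    simp


lemma flat_mem (hi : Inv X) (hT : ∀ n, Ext (T n) (T (n + 1))) (n : ℕ) {y : ℤ → (T n).Bt}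
    (hy : y ∈ XLevel (A := fun n => (T n).Bt) (fun n => sig (T n) (T (n + 1))) n) :
    (T n).flat y ∈ (T n).E := by
  rw [← (T n).closed.closure_eq, mem_closure_iff]
  intro U hU hyU
  obtain ⟨N, hN⟩ := window_lemma (K := {(T n).flat y}) isCompact_singleton hU (by simpa using hyU)
  obtain ⟨k, -, a, ha⟩ := hy (-(N + 1 : ℕ)) (2 * N + 2)
  obtain ⟨x, hx, rfl⟩ := (T (n + k)).cd_surj a
  rw [sadic_cd hi hT n k x hx] at ha
  obtain ⟨a, -, hab⟩ := infix_factorAt ha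
  rw [factorAt_length, factorAt_eq_iff] at hab
  have hxn := tower_sub hT n k hx
  have hx' := (T n).mem_mul hi (a + (N + 1 : ℕ)) x hxn
  refine ⟨_, hN _ rfl (shiftBy ((a + (N + 1 : ℕ) : ℤ) * (T n).p) x) ?_, hx'⟩
  intro i hiN
  rw [abs_le] at hiN
  conv_rhs => rw [← (T n).flat_code hi hx']
  have hp : (1 : ℤ) ≤ (T n).p := by exact_mod_cast (T n).pos
  have h1 : -(N : ℤ) ≤ i / (T n).p := by
    rw [Int.le_ediv_iff_mul_le (by omega)]; nlinarith
  have h2 : i / (T n).p < N + 1 := by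
    rw [Int.ediv_lt_iff_lt_mul (by omega)]; nlinarith
  have := hab (i / (T n).p + (N + 1 : ℕ)).toNat (by omega)
  rw [Int.toNat_of_nonneg (by omega)] at this
  unfold Lev.flat
  rw [Lev.code_shift]
  rw [show (-((N + 1 : ℕ) : ℤ) + (i / (T n).p + (N + 1 : ℕ))) = i / (T n).p by ring] at this
  rw [this]
  simp only [shiftBy]
  rw [show (a : ℤ) + (i / (T n).p + (N + 1 : ℕ)) = i / (T n).p + (a + (N + 1 : ℕ)) by ring]

lemma isOpen_agree (z : ℤ → ℤ) (p : ℕ) : IsOpen {x : ℤ → ℤ | ∀ i : ℕ, i < p → x i = z i} := by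
  have := isOpen_biInter_finset (s := Finset.range p)
    (f := fun i : ℕ => {x : ℤ → ℤ | x i = z i}) (fun i _ => isOpen_coord i _)
  convert this using 1
  ext x; simp

lemma code_mem (hc : IsCompact X) (hi : Inv X) (hm : Mini X)
    (hT : ∀ n, Ext (T n) (T (n + 1))) (h0 : (T 0).p = 1) {x : ℤ → ℤ}
    (hx : x ∈ X) :
    (T 0).code x ∈ XLevel (A := fun n => (T n).Bt) (fun n => sig (T n) (T (n + 1))) 0 := by
  intro i m
  obtain ⟨M, hM⟩ := syndetic hc hi hm (isOpen_agree (shiftBy i x) m)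
    ⟨shiftBy i x, hi _ _ hx, fun _ _ => rfl⟩
  have hne : X.Nonempty := ⟨x, hx⟩
  obtain ⟨z, hz⟩ := (T (0 + (M + m + 1))).nonemptyE hne
  refine ⟨M + m + 1, by omega, (T (0 + (M + m + 1))).cd z, ?_⟩
  rw [sadic_cd hi hT 0 _ z hz]
  obtain ⟨j, hj, hjU⟩ := hM z ((T (0 + (M + m + 1))).sub hz)
  have hlarge := tower_large hT 0 (M + m + 1)
  have heq : factorAt ((T 0).code x) i m = factorAt ((T 0).code z) j m := by
    rw [factorAt_eq_iff]
    intro l hl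
    unfold Lev.code Lev.cd
    congr 1
    funext s
    have hs : (s : ℕ) = 0 := by have := s.2; omega
    have := hjU l hl
    simp only [shiftBy] at this
    simp only [Lev.rd, shiftBy, hs, h0]
    simp only [Nat.cast_zero, Nat.cast_one, mul_one, zero_add]
    rw [add_comm i, add_comm (j : ℤ), this]
  show (factorAt ((T 0).code x) i m).IsInfix _
  rw [heq, h0, Nat.div_one]
  exact factorAt_infix _ _ _ _ (by omega)

lemma primitive_tower (hc : IsCompact X) (hi : Inv X) (hm : Mini X)
    (hT : ∀ n, Ext (T n) (T (n + 1))) :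
    PrimitiveSeq (A := fun n => (T n).Bt) (fun n => sig (T n) (T (n + 1))) := by
  intro n
  have key : ∀ b : (T n).Bt, ∃ M : ℕ, ∀ x ∈ (T n).E, ∃ c : ℕ, c * (T n).p < M ∧
      (T n).code x c = b := by
    intro b
    obtain ⟨z, hz, rfl⟩ := (T n).cd_surj b
    obtain ⟨U, hU, hUE⟩ := (T n).op
    obtain ⟨M, hM⟩ := syndetic hc hi hm (hU.inter (isOpen_agree z (T n).p))
      ⟨z, (T n).sub hz, by rw [hUE] at hz; exact hz.2, fun _ _ => rfl⟩
    refine ⟨M, fun x hx => ?_⟩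
    obtain ⟨j, hj, hjU, hjz⟩ := hM x ((T n).sub hx)
    have hjE : shiftBy j x ∈ (T n).E := by
      rw [hUE]; exact ⟨hi _ _ ((T n).sub hx), hjU⟩
    have hdvd := ((T n).mem_iff hi hx j).1 hjE
    obtain ⟨c, rfl⟩ := Int.natCast_dvd_natCast.1 hdvd
    refine ⟨c, by rwa [mul_comm], ?_⟩
    unfold Lev.code Lev.cd
    congr 1
    funext s
    have := hjz s s.2
    simp only [Lev.rd]
    rw [← this]
    congr 2
    push_cast; ring
  choose M hM using key
  have := finite_Bt hc (T n)
  obtain ⟨K, hK⟩ := (Set.finite_range M).bddAbove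
  refine ⟨K + 1, by omega, ?_⟩
  intro a b
  obtain ⟨x, hx, rfl⟩ := (T (n + (K + 1))).cd_surj a
  rw [sadic_cd hi hT n _ x hx]
  obtain ⟨c, hcM, hcb⟩ := hM b x (tower_sub hT n _ hx)
  have hMK : M b ≤ K := hK ⟨b, rfl⟩
  have hlarge := tower_large hT n (K + 1)
  rw [factorAt_eq_map, List.mem_map]
  refine ⟨c, List.mem_range.2 ?_, by simpa using hcb⟩
  obtain ⟨R, hR⟩ := tower_dvd hT n (K + 1)
  rw [hR, Nat.mul_div_cancel_left _ (T n).pos]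
  have h1 : (T n).p * c < (T n).p * R := by rw [← hR, mul_comm]; omega
  exact lt_of_mul_lt_mul_left h1 (Nat.zero_le _)

lemma proper_tower (hi : Inv X)
    (hT : ∀ n, Ext (T n) (T (n + 1))) :
    ProperSeq (A := fun n => (T n).Bt) (fun n => sig (T n) (T (n + 1))) := by
  intro n
  obtain ⟨hsub, ⟨Q, hQ⟩, hlt, -, h, hh⟩ := hT n
  have hp := (T n).pos
  have hq : (T (n + 1)).p / (T n).p = Q := by rw [hQ, Nat.mul_div_cancel_left _ hp]
  have hQ0 : 0 < Q := by
    rcases Nat.eq_zero_or_pos Q with h0 | h0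
    · rw [h0] at hQ; omega
    · exact h0
  refine ⟨(T n).toBt (fun i => h i), (T n).toBt (fun i => h (i - (T n).p)), ?_⟩
  intro a
  obtain ⟨x, hx, rfl⟩ := (T (n + 1)).cd_surj a
  show (sig (T n) (T (n + 1)) ((T (n + 1)).cd x)).head? = _ ∧
    (sig (T n) (T (n + 1)) ((T (n + 1)).cd x)).getLast? = _
  rw [sig_cd (hT n).2.1 hx, hq]
  constructor
  · rw [List.head?_eq_getElem?, List.getElem?_eq_getElem (by rwa [factorAt_length]),
      factorAt_getElem]
    congr 1
    unfold Lev.code Lev.cd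
    congr 1
    funext i
    have hi2 := i.2
    simp only [Lev.rd, shiftBy]
    rw [← hh x hx i (by omega) (by omega)]
    simp
  · rw [List.getLast?_eq_getElem?, factorAt_length,
      List.getElem?_eq_getElem (by rw [factorAt_length]; omega), factorAt_getElem]
    congr 1
    unfold Lev.code Lev.cd
    congr 1
    funext i
    have hi2 := i.2
    simp only [Lev.rd]
    rw [← hh _ ((T (n + 1)).step x hx) (i - (T n).p) (by omega) (by omega)]
    simp only [shiftBy]
    congr 1
    rw [hQ]
    push_cast [Nat.cast_sub hQ0]
    ring

lemma concat_code (hi : Inv X) (hT : ∀ n, Ext (T n) (T (n + 1))) (n : ℕ)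
    {x : ℤ → ℤ} (hx : x ∈ (T (n + 1)).E) {z : ℤ → (T n).Bt}
    (h : IsConcat (sig (T n) (T (n + 1))) ((T (n + 1)).code x) z) : z = (T n).code x := by
  obtain ⟨c, hc0, hc1, hc2⟩ := h
  obtain ⟨hsub, ⟨Q, hQ⟩, hlt, -⟩ := hT n
  have hp := (T n).pos
  have hq : (T (n + 1)).p / (T n).p = Q := by rw [hQ, Nat.mul_div_cancel_left _ hp]
  have hQ0 : 0 < Q := by
    rcases Nat.eq_zero_or_pos Q with h0 | h0
    · rw [h0] at hQ; omega
    · exact h0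
  have hlen : ∀ w, (sig (T n) (T (n + 1)) w).length = Q := by
    intro w; unfold sig; rw [factorAt_length, hq]
  have hcj : ∀ j : ℤ, c j = j * Q := by
    intro j
    induction j using Int.induction_on with
    | zero => simp [hc0]
    | succ i ih => rw [hc1, ih, hlen]; ring
    | pred i ih =>
      have := hc1 (-i - 1)
      rw [hlen, sub_add_cancel, ih] at this
      linarith
  funext m
  have hQ0' : (0 : ℤ) < Q := by exact_mod_cast hQ0
  have h2 := Int.emod_nonneg m hQ0'.ne'
  have h3 := Int.emod_lt_of_pos m hQ0'
  have h4 := Int.emod_add_mul_ediv m Q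
  have := hc2 (m / Q) ⟨(m % Q).toNat, by rw [hlen]; omega⟩
  rw [hcj, List.get_eq_getElem] at this
  simp only [Int.toNat_of_nonneg h2] at this
  rw [show m / (Q : ℤ) * Q + m % Q = m by linarith [mul_comm (Q : ℤ) (m / Q)]] at this
  rw [this]
  have e : sig (T n) (T (n + 1)) ((T (n + 1)).code x (m / Q)) =
      factorAt ((T n).code (shiftBy (m / Q * (T (n + 1)).p) x)) 0 Q := by
    rw [← hq]
    exact sig_cd (hT n).2.1 ((T (n + 1)).mem_mul hi _ x hx)
  simp only [e]
  rw [factorAt_getElem, Int.toNat_of_nonneg h2,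
    show m / (Q : ℤ) * ((T (n + 1)).p : ℤ) = (m / Q * Q) * (T n).p by
      rw [hQ]; push_cast; ring, Lev.code_shift]
  simp only [shiftBy]
  congr 1
  linarith [mul_comm (Q : ℤ) (m / Q)]

lemma recog_tower (hi : Inv X) (hT : ∀ n, Ext (T n) (T (n + 1))) :
    RecognizableSeq (A := fun n => (T n).Bt) (fun n => sig (T n) (T (n + 1))) := by
  intro n ξ y y' k k' ⟨hy, hk, hcon⟩ ⟨hy', hk', hcon'⟩
  have hx := flat_mem hi hT (n + 1) hy
  have hx' := flat_mem hi hT (n + 1) hy'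
  have ey := (T (n + 1)).code_flat hi hx
  have ey' := (T (n + 1)).code_flat hi hx'
  obtain ⟨hsub, ⟨Q, hQ⟩, hlt, -⟩ := hT n
  have hp := (T n).pos
  have hq : (T (n + 1)).p / (T n).p = Q := by rw [hQ, Nat.mul_div_cancel_left _ hp]
  have hlen : ∀ w, (sig (T n) (T (n + 1)) w).length = Q := by
    intro w; unfold sig; rw [factorAt_length, hq]
  simp only [hlen] at hk hk'
  generalize (T (n + 1)).flat y = x at hx ey
  generalize (T (n + 1)).flat y' = x' at hx' ey'
  subst ey
  subst ey'
  have h1 := concat_code hi hT n hx hcon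
  have h1' := concat_code hi hT n hx' hcon'
  have e1 : ξ = (T n).code (shiftBy (k * (T n).p) x) := by
    rw [Lev.code_shift, ← h1]
    funext m; simp [shiftBy]
  have e1' : ξ = (T n).code (shiftBy (k' * (T n).p) x') := by
    rw [Lev.code_shift, ← h1']
    funext m; simp [shiftBy]
  have e2 := (T n).code_inj hi ((T n).mem_mul hi k x (hsub hx))
    ((T n).mem_mul hi k' x' (hsub hx')) (e1.symm.trans e1')
  have e3 : x' = shiftBy ((k - k' : ℤ) * (T n).p) x := by
    have := congrArg (shiftBy (-(k' * (T n).p : ℤ))) e2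
    rw [shiftBy_shiftBy, shiftBy_shiftBy, neg_add_cancel, shiftBy_zero] at this
    rw [← this]
    congr 1; ring
  have hd : ((T (n + 1)).p : ℤ) ∣ (k - k' : ℤ) * (T n).p := by
    rw [← (T (n + 1)).mem_iff hi hx, ← e3]; exact hx'
  rw [hQ, Nat.cast_mul, mul_comm ((k : ℤ) - k')] at hd
  have hd2 : (Q : ℤ) ∣ (k - k' : ℤ) :=
    Int.dvd_of_mul_dvd_mul_left (by exact_mod_cast hp.ne') hd
  have hkk : (k : ℤ) - k' = 0 := Int.eq_zero_of_abs_lt_dvd hd2 (by rw [abs_lt]; omega)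
  rw [hkk, zero_mul, shiftBy_zero] at e3
  exact ⟨by rw [e3], by omega⟩

lemma rank_tower (hT : ∀ n, Ext (T n) (T (n + 1))) (iB : ∀ n, Fintype (T n).Bt) :
    @AlphabetRankLE (fun n => (T n).Bt) iB 2 := by
  intro N
  refine ⟨N + 1, by omega, ?_⟩
  obtain ⟨-, -, -, ⟨f, g, hfg⟩, -⟩ := hT N
  classical
  have hor : ∀ w : (T (N + 1)).Bt, (∀ i, w.1 i = f (i : ℕ)) ∨ (∀ i, w.1 i = g (i : ℕ)) := by
    rintro ⟨w, x, hx, rfl⟩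
    rcases hfg x hx with h | h
    · left; intro i; exact h i i.2
    · right; intro i; exact h i i.2
  have hinj : Function.Injective
      (fun w : (T (N + 1)).Bt => decide (∀ i, w.1 i = f (i : ℕ))) := by
    intro w w' h
    simp only [decide_eq_decide] at h
    apply Subtype.ext
    funext i
    by_cases h1 : ∀ i, w.1 i = f (i : ℕ)
    · rw [h1 i, (h.1 h1) i]
    · rw [(hor w).resolve_left h1 i, (hor w').resolve_left (fun h2 => h1 (h.2 h2)) i]
  have := @Fintype.card_le_of_injective _ _ (iB (N + 1)) _ _ hinj
  simpa using this

end tower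

lemma strong_of_good {X : Set (ℤ → ℤ)} (hne : X.Nonempty) (hc : IsCompact X) (hi : Inv X)
    (hm : Mini X) (hG : ∀ m, Good m X) : IsStrongToeplitzOfRank X 2 := by
  have _ : Nonempty ↥X := hne.to_subtype
  obtain ⟨T, h0, hE, hT⟩ := exists_tower hne hc hi hm hG
  have hfin := fun n => finite_Bt hc (T n)
  let iB : ∀ n, Fintype (T n).Bt := fun n => Fintype.ofFinite _
  have hlen : ∀ n w, (sig (T n) (T (n + 1)) w).length = (T (n + 1)).p / (T n).p := by
    intro n w; unfold sig; rw [factorAt_length]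
  refine ⟨fun n => (T n).Bt, iB, fun n => sig (T n) (T (n + 1)), ?_, ?_,
    primitive_tower hc hi hm hT, proper_tower hi hT, recog_tower hi hT, rank_tower hT iB, ?_⟩
  · intro n a ha
    have h1 := hlen n a
    change sig (T n) (T (n + 1)) a = [] at ha
    rw [ha, List.length_nil] at h1
    have h2 := Nat.div_pos (hT n).2.2.1.le (T n).pos
    omega
  · intro n a b
    rw [hlen, hlen]
  · let _ : TopologicalSpace (T 0).Bt := ⊥
    have _ : DiscreteTopology (T 0).Bt := ⟨rfl⟩
    have hcode : Continuous (T 0).code := by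
      refine continuous_pi (fun j => ?_)
      have h1 : Continuous (T 0).toBt := continuous_of_discreteTopology
      have h2 : Continuous (T 0).rd := by unfold Lev.rd; fun_prop
      exact h1.comp (h2.comp (continuous_shiftBy _))
    have hflat : Continuous (T 0).flat := by
      refine continuous_pi (fun j => ?_)
      have h1 : Continuous (fun b : (T 0).Bt => b.1 ⟨(j % (T 0).p).toNat, (T 0).emod_lt j⟩) :=
        continuous_of_discreteTopology
      exact h1.comp (continuous_apply _)
    refine ⟨{ toFun := fun x => ⟨(T 0).code x.1, code_mem hc hi hm hT h0 x.2⟩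
              invFun := fun y => ⟨(T 0).flat y.1, (T 0).sub (flat_mem hi hT 0 y.2)⟩
              left_inv := fun x => Subtype.ext ((T 0).flat_code hi (by rw [hE]; exact x.2))
              right_inv := fun y => Subtype.ext ((T 0).code_flat hi (flat_mem hi hT 0 y.2))
              continuous_toFun := by fun_prop
              continuous_invFun := by fun_prop }, ?_⟩
    intro x hx hx'
    show (T 0).code (shift x) = shift ((T 0).code x)
    rw [shift_eq_shiftBy, shift_eq_shiftBy, ← Lev.code_shift, h0]
    simp

/-! ### Concatenations of two words of equal length -/

/-- The concatenation of blocks `w (y j)` of length `p`. -/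
def cat (p : ℕ) (w : Bool → ℕ → ℤ) (y : ℤ → Bool) : ℤ → ℤ :=
  fun n => w (y (n / p)) (n % p).toNat

lemma cat_val {p : ℕ} (w : Bool → ℕ → ℤ) (y : ℤ → Bool) (n j : ℤ) (i : ℕ) (hi : i < p)
    (h : n = j * p + i) : cat p w y n = w (y j) i := by
  have h1 : n / p = j := by
    rw [h, add_comm, Int.add_mul_ediv_right _ _ (by omega), Int.ediv_eq_zero_of_lt] <;> omega
  have h2 : n % p = i := by
    rw [h, add_comm, Int.add_mul_emod_self_right, Int.emod_eq_of_lt] <;> omega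
  simp [cat, h1, h2]

lemma exists_block {p : ℕ} (hp : 0 < p) (n : ℤ) : ∃ (j : ℤ) (i : ℕ), i < p ∧ n = j * p + i := by
  have hp' : (0 : ℤ) < p := by exact_mod_cast hp
  have h2 := Int.emod_nonneg n hp'.ne'
  have h3 := Int.emod_lt_of_pos n hp'
  have h4 := Int.emod_add_mul_ediv n p
  refine ⟨n / p, (n % p).toNat, by omega, ?_⟩
  rw [Int.toNat_of_nonneg h2]
  linarith [mul_comm (p : ℤ) (n / p)]

lemma eq_cat {p : ℕ} (hp : 0 < p) (w : Bool → ℕ → ℤ) (y : ℤ → Bool) (z : ℤ → ℤ)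
    (h : ∀ (j : ℤ) (i : ℕ), i < p → z (j * p + i) = w (y j) i) : z = cat p w y := by
  funext n
  obtain ⟨j, i, hi, rfl⟩ := exists_block hp n
  rw [h j i hi, cat_val w y _ j i hi rfl]

lemma cat_shift {p : ℕ} (hp : 0 < p) (w : Bool → ℕ → ℤ) (y : ℤ → Bool) (k : ℤ) :
    shiftBy (k * p) (cat p w y) = cat p w (shiftBy k y) := by
  apply eq_cat hp
  intro j i hi
  exact cat_val w y _ (j + k) i hi (by ring)

lemma continuous_cat (p : ℕ) (w : Bool → ℕ → ℤ) : Continuous (cat p w) := by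
  refine continuous_pi (fun n => ?_)
  have h1 : Continuous (fun b : Bool => w b (n % p).toNat) := continuous_of_discreteTopology
  exact h1.comp (continuous_apply (n / (p : ℤ)))

lemma bool_swap {a b c : Bool} (h1 : a ≠ b) (h2 : c ≠ b) : a = c := by
  cases a <;> cases b <;> cases c <;> simp_all

lemma bool_invol : ∀ (f : Bool → Bool), f true ≠ f false → ∀ b, f (f b) = b := by decide

/-- Recognizability: two different phases force periodicity. -/
lemma two_phases {p s : ℕ} (w : Bool → ℕ → ℤ) (hs : 0 < s) (hsp : s < p)
    (hw : ∃ i, i < p ∧ w false i ≠ w true i) (y y' : ℤ → Bool)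
    (h : shiftBy s (cat p w y) = cat p w y') :
    ∃ q : ℤ, 0 < q ∧ ∀ n, cat p w y (n + q) = cat p w y n := by
  have hp : 0 < p := by omega
  have key1 : ∀ (j : ℤ) (i : ℕ), s + i < p → w (y j) (s + i) = w (y' j) i := by
    intro j i hi
    have := congrFun h (j * p + i)
    rw [cat_val w y' _ j i (by omega) rfl] at this
    rw [← this]
    exact (cat_val w y _ j (s + i) hi (by push_cast; ring)).symm
  have key2 : ∀ (j : ℤ) (i : ℕ), i < p → p ≤ s + i → w (y (j + 1)) (s + i - p) = w (y' j) i := by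
    intro j i hi hi2
    have := congrFun h (j * p + i)
    rw [cat_val w y' _ j i hi rfl] at this
    rw [← this]
    exact (cat_val w y _ (j + 1) (s + i - p) (by omega) (by push_cast [Nat.cast_sub hi2]; ring)).symm
  have weq : ∀ {a b : Bool}, (∀ i, i < p → w a i = w b i) → a = b := by
    intro a b hab
    obtain ⟨i, hi, hne⟩ := hw
    have := hab i hi
    clear key1 key2 h hab
    cases a <;> cases b <;> simp_all
  have hdiff : ∀ {a b : Bool} {i : ℕ}, w false i ≠ w true i → w a i = w b i → a = b := by
    intro a b i hne hab
    clear key1 key2 h weq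
    cases a <;> cases b <;> simp_all
  have hsame : ∀ (a b : Bool) {i : ℕ}, w false i = w true i → w a i = w b i := by
    intro a b i hne
    clear key1 key2 h weq hdiff
    cases a <;> cases b <;> simp_all
  -- the uniform argument in the case where one of the two parts is common
  have main : ∀ e : ℤ, e = 0 ∨ e = 1 → (∀ j l, y' j = y' l ↔ y (j + e) = y (l + e)) →
      (∀ (f : Bool → Bool), (∀ j, y' j = f (y (j + e))) → (∃ j, y j = true) → (∃ j, y j = false) →
        ∀ u, shiftBy s (cat p w u) = cat p w (fun j => f (u (j + e)))) →
      ∃ q : ℤ, 0 < q ∧ ∀ n, cat p w y (n + q) = cat p w y n := by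
    intro e he hiff hcat
    by_cases hT : ∃ j, y j = true
    swap
    · refine ⟨p, by exact_mod_cast hp, fun n => ?_⟩
      push Not at hT
      have hy : y = fun _ => false := by funext j; simpa using hT j
      have := congrFun (cat_shift hp w y 1) n
      rw [one_mul] at this
      rw [show cat p w y (n + p) = shiftBy p (cat p w y) n from rfl, this, hy]
      rfl
    by_cases hF : ∃ j, y j = false
    swap
    · refine ⟨p, by exact_mod_cast hp, fun n => ?_⟩
      push Not at hF
      have hy : y = fun _ => true := by funext j; simpa using hF j
      have := congrFun (cat_shift hp w y 1) n
      rw [one_mul] at this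
      rw [show cat p w y (n + p) = shiftBy p (cat p w y) n from rfl, this, hy]
      rfl
    obtain ⟨jt, hjt⟩ := hT
    obtain ⟨jf, hjf⟩ := hF
    let f : Bool → Bool := fun b => if b then y' (jt - e) else y' (jf - e)
    have hf : ∀ j, y' j = f (y (j + e)) := by
      intro j
      cases hc : y (j + e)
      · show y' j = y' (jf - e)
        rw [hiff, sub_add_cancel, hc, hjf]
      · show y' j = y' (jt - e)
        rw [hiff, sub_add_cancel, hc, hjt]
    have hne : f true ≠ f false := by
      intro h1
      have h2 : y' (jt - e) = y' (jf - e) := h1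
      rw [hiff, sub_add_cancel, sub_add_cancel, hjt, hjf] at h2
      simp at h2
    have hff : ∀ b, f (f b) = b := bool_invol f hne
    have hc := hcat f hf ⟨jt, hjt⟩ ⟨jf, hjf⟩
    have h2 : shiftBy (s + s) (cat p w y) = cat p w (shiftBy (e + e) y) := by
      rw [← shiftBy_shiftBy, hc, hc]
      congr 1
      funext j
      simp only [hff, shiftBy, add_assoc]
    rw [← cat_shift hp] at h2
    refine ⟨if e = 0 then 2 * s else 2 * (p - s), by split_ifs <;> omega, fun n => ?_⟩
    rcases he with rfl | rfl
    · have := congrFun h2 n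
      simp only [shiftBy] at this
      simp only [if_true]
      convert this using 2 <;> ring
    · have := congrFun h2 (n - 2 * s)
      simp only [shiftBy] at this
      simp only [one_ne_zero, if_false]
      convert this.symm using 2 <;> ring
  by_cases D1 : ∃ i, i < s ∧ w false i ≠ w true i
  · by_cases D2 : ∃ i, s ≤ i ∧ i < p ∧ w false i ≠ w true i
    · -- both parts differ
      obtain ⟨i1, hi1, hn1⟩ := D1
      obtain ⟨i2, hi2, hi2', hn2⟩ := D2
      have pair : ∀ j l, y' j = y' l → y j = y l ∧ y (j + 1) = y (l + 1) := by
        intro j l hjl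
        constructor
        · have a := key1 j (i2 - s) (by omega)
          have b := key1 l (i2 - s) (by omega)
          rw [hjl, ← b] at a
          rw [show s + (i2 - s) = i2 by omega] at a
          exact hdiff hn2 a
        · have a := key2 j (i1 + p - s) (by omega) (by omega)
          have b := key2 l (i1 + p - s) (by omega) (by omega)
          rw [hjl, ← b] at a
          rw [show s + (i1 + p - s) - p = i1 by omega] at a
          exact hdiff hn1 a
      have per : ∀ j, y (j + 2) = y j := by
        intro j
        have e2 : j + 1 + 1 = j + 2 := by ring
        have e3 : j - 1 + 1 = j := by ring
        by_cases c1 : y' j = y' (j + 1)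
        · have := pair _ _ c1
          rw [e2] at this
          rw [← this.2, this.1]
        by_cases c2 : y' (j + 2) = y' j
        · exact (pair _ _ c2).1
        have c3 : y' (j + 2) = y' (j + 1) := bool_swap c2 (fun h => c1 h.symm)
        have h3 := (pair _ _ c3).1
        by_cases c4 : y' (j - 1) = y' j
        · have h4 := (pair _ _ c4).2
          rw [e3] at h4
          rw [h3, ← h4]
        · have c5 : y' (j - 1) = y' (j + 1) := bool_swap c4 (fun h => c1 h.symm)
          have h5 := (pair _ _ c5).2
          rw [e3, e2] at h5
          exact h5.symm
      refine ⟨2 * p, by omega, fun n => ?_⟩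
      have := congrFun (cat_shift hp w y 2) n
      rw [show shiftBy 2 y = y from funext per] at this
      exact this
    · -- the second parts agree
      have hag : ∀ i, s ≤ i → i < p → w false i = w true i := by
        intro i h1 h2
        by_contra h3
        exact D2 ⟨i, h1, h2, h3⟩
      refine main 1 (Or.inr rfl) ?_ ?_
      · intro j l
        constructor
        · intro hjl
          apply weq
          intro i hi
          by_cases his : i < s
          · have a := key2 j (i + p - s) (by omega) (by omega)
            have b := key2 l (i + p - s) (by omega) (by omega)
            rw [hjl, ← b] at a
            rwa [show s + (i + p - s) - p = i by omega] at a
          · exact hsame _ _ (hag i (by omega) hi)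
        · intro hjl
          apply weq
          intro i hi
          by_cases his : s + i < p
          · rw [← key1 j i his, ← key1 l i his]
            exact hsame _ _ (hag _ (by omega) his)
          · rw [← key2 j i hi (by omega), ← key2 l i hi (by omega), hjl]
      · intro f hf ⟨jt, hjt⟩ ⟨jf, hjf⟩ u
        apply eq_cat hp
        intro j i hi
        have hm : ∀ b : Bool, ∃ m, y (m + 1) = b := by
          intro b
          cases b
          · exact ⟨jf - 1, by rwa [sub_add_cancel]⟩
          · exact ⟨jt - 1, by rwa [sub_add_cancel]⟩
        obtain ⟨m, hm⟩ := hm (u (j + 1))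
        have hfm := hf m
        rw [hm] at hfm
        show cat p w u (j * p + i + s) = _
        by_cases his : s + i < p
        · rw [cat_val w u _ j (s + i) his (by push_cast; ring), ← hfm, ← key1 m i his]
          exact hsame _ _ (hag _ (by omega) his)
        · rw [cat_val w u _ (j + 1) (s + i - p) (by omega)
            (by push_cast [Nat.cast_sub (show p ≤ s + i by omega)]; ring), ← hfm,
            ← key2 m i hi (by omega), hm]
  · -- the first parts agree
    have hag : ∀ i, i < s → w false i = w true i := by
      intro i h1
      by_contra h3
      exact D1 ⟨i, h1, h3⟩
    refine main 0 (Or.inl rfl) ?_ ?_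
    · intro j l
      rw [add_zero, add_zero]
      constructor
      · intro hjl
        apply weq
        intro i hi
        by_cases his : i < s
        · exact hsame _ _ (hag i his)
        · have a := key1 j (i - s) (by omega)
          have b := key1 l (i - s) (by omega)
          rw [hjl, ← b] at a
          rwa [show s + (i - s) = i by omega] at a
      · intro hjl
        apply weq
        intro i hi
        by_cases his : s + i < p
        · rw [← key1 j i his, ← key1 l i his, hjl]
        · rw [← key2 j i hi (by omega), ← key2 l i hi (by omega)]
          exact hsame _ _ (hag _ (by omega))
    · intro f hf ⟨jt, hjt⟩ ⟨jf, hjf⟩ u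
      apply eq_cat hp
      intro j i hi
      have hm : ∀ b : Bool, ∃ m, y m = b := by
        intro b
        cases b
        · exact ⟨jf, hjf⟩
        · exact ⟨jt, hjt⟩
      obtain ⟨m, hm⟩ := hm (u j)
      have hfm := hf m
      rw [add_zero, hm] at hfm
      show cat p w u (j * p + i + s) = w (f (u (j + 0))) i
      rw [add_zero]
      by_cases his : s + i < p
      · rw [cat_val w u _ j (s + i) his (by push_cast; ring), ← hfm, ← key1 m i his, hm]
      · rw [cat_val w u _ (j + 1) (s + i - p) (by omega)
          (by push_cast [Nat.cast_sub (show p ≤ s + i by omega)]; ring), ← hfm,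
          ← key2 m i hi (by omega)]
        exact hsame _ _ (hag _ (by omega))


/-! ### The Toeplitz construction -/

/-- The lengths of the words of level `k`. -/
def PP (l : ℕ) : ℕ → ℕ
  | 0 => l
  | k + 1 => (k + 6).factorial * PP l k

/-- The substitution used at every level. -/
def tau (b : Bool) (j : ℕ) : Bool := decide (j = 1 ∨ j = 2 ∨ (b = true ∧ j = 3))

/-- The words of level `k`. -/
def Wd (l : ℕ) (W0 : Bool → ℕ → ℤ) : ℕ → Bool → ℕ → ℤ
  | 0 => W0
  | k + 1 => fun b i => Wd l W0 k (tau b (i / PP l k)) (i % PP l k)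

/-- Action of the substitution on sequences. -/
def subs (c : ℕ) (y : ℤ → Bool) : ℤ → Bool := fun m => tau (y (m / c)) (m % c).toNat

lemma subs_val {c : ℕ} (y : ℤ → Bool) (n j : ℤ) (i : ℕ) (hi : i < c)
    (h : n = j * c + i) : subs c y n = tau (y j) i := by
  have h1 : n / c = j := by
    rw [h, add_comm, Int.add_mul_ediv_right _ _ (by omega), Int.ediv_eq_zero_of_lt] <;> omega
  have h2 : n % c = i := by
    rw [h, add_comm, Int.add_mul_emod_self_right, Int.emod_eq_of_lt] <;> omega
  simp [subs, h1, h2]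

lemma lt_PP {l : ℕ} (hl : 0 < l) (k : ℕ) : k < PP l k := by
  induction k with
  | zero => exact hl
  | succ k ih =>
    have h1 : 1 ≤ PP l k := by omega
    have h2 : k + 6 ≤ (k + 6).factorial := Nat.self_le_factorial _
    calc k + 1 < (k + 6).factorial * 1 := by omega
      _ ≤ (k + 6).factorial * PP l k := Nat.mul_le_mul_left _ h1

lemma PP_pos {l : ℕ} (hl : 0 < l) (k : ℕ) : 0 < PP l k := lt_of_le_of_lt (Nat.zero_le _) (lt_PP hl k)

lemma fac_ge (k : ℕ) : 6 ≤ (k + 6).factorial :=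
  le_trans (by omega) (Nat.self_le_factorial (k + 6))

lemma cat_succ {l : ℕ} (hl : 0 < l) (W0 : Bool → ℕ → ℤ) (k : ℕ) (y : ℤ → Bool) :
    cat (PP l k) (Wd l W0 k) (subs (k + 6).factorial y)
      = cat (PP l (k + 1)) (Wd l W0 (k + 1)) y := by
  apply eq_cat (PP_pos hl _)
  intro j i hi
  have hP := PP_pos hl k
  have hq : i / PP l k < (k + 6).factorial := by
    rw [Nat.div_lt_iff_lt_mul hP]; exact hi
  rw [cat_val _ _ _ (j * (k + 6).factorial + (i / PP l k : ℕ)) (i % PP l k) (Nat.mod_lt _ hP),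
    subs_val y _ j (i / PP l k) hq rfl]
  · rfl
  · have := Nat.mod_add_div i (PP l k)
    have h2 : (i : ℤ) = (i % PP l k : ℕ) + (PP l k : ℤ) * (i / PP l k : ℕ) := by exact_mod_cast this.symm
    have h3 : (PP l (k + 1) : ℤ) = (k + 6).factorial * (PP l k : ℤ) := by
      simp [PP]
    rw [h3]
    nth_rewrite 1 [h2]
    ring

lemma Wd_ne {l : ℕ} (hl : 0 < l) {W0 : Bool → ℕ → ℤ} (h : ∃ i, i < l ∧ W0 false i ≠ W0 true i)
    (k : ℕ) : ∃ i, i < PP l k ∧ Wd l W0 k false i ≠ Wd l W0 k true i := by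
  induction k with
  | zero => exact h
  | succ k ih =>
    obtain ⟨i, hi, hne⟩ := ih
    have hP := PP_pos hl k
    refine ⟨3 * PP l k + i, ?_, ?_⟩
    · show _ < (k + 6).factorial * PP l k
      have := Nat.mul_le_mul_right (PP l k) (fac_ge k)
      omega
    · have h1 : (3 * PP l k + i) / PP l k = 3 := by
        rw [mul_comm, Nat.mul_add_div hP, Nat.div_eq_of_lt hi]
      have h2 : (3 * PP l k + i) % PP l k = i := by
        rw [mul_comm, Nat.mul_add_mod, Nat.mod_eq_of_lt hi]
      simp only [Wd, h1, h2]
      simpa [tau] using hne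

lemma subs_pairs {c : ℕ} (hc : 6 ≤ c) (y : ℤ → Bool) (a b : Bool) :
    ∃ r : ℤ, subs c y r = a ∧ subs c y (r + 1) = b := by
  have hv : ∀ i : ℕ, i < 6 → subs c y i = tau (y 0) i := fun i hi =>
    subs_val y i 0 i (by omega) (by simp)
  have h0 := hv 0 (by omega)
  have h1 := hv 1 (by omega)
  have h2 := hv 2 (by omega)
  have h3 := hv 3 (by omega)
  have h4 := hv 4 (by omega)
  have h5 := hv 5 (by omega)
  cases hy : y 0 <;> simp [tau, hy] at h0 h1 h2 h3 h4 h5 <;> cases a <;> cases b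
  · exact ⟨4, h4, h5⟩
  · exact ⟨0, h0, h1⟩
  · exact ⟨2, h2, h3⟩
  · exact ⟨1, h1, h2⟩
  · exact ⟨4, h4, h5⟩
  · exact ⟨0, h0, h1⟩
  · exact ⟨3, h3, h4⟩
  · exact ⟨1, h1, h2⟩

lemma cat_agree {p : ℕ} (w : Bool → ℕ → ℤ) {u v : ℤ → Bool} {j r : ℤ} (h0 : u j = v r)
    (h1 : u (j + 1) = v (r + 1)) (n : ℤ) (hn : 0 ≤ n) (hn2 : n < 2 * p) :
    cat p w u (j * p + n) = cat p w v (r * p + n) := by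
  by_cases h : n < p
  · rw [cat_val w u _ j n.toNat (by omega) (by omega),
      cat_val w v _ r n.toNat (by omega) (by omega), h0]
  · rw [cat_val w u _ (j + 1) (n - p).toNat (by omega)
        (by rw [Int.toNat_of_nonneg (by omega)]; ring),
      cat_val w v _ (r + 1) (n - p).toNat (by omega)
        (by rw [Int.toNat_of_nonneg (by omega)]; ring), h1]

/-- All shifts of concatenations. -/
def Cs (p : ℕ) (w : Bool → ℕ → ℤ) : Set (ℤ → ℤ) := {z | ∃ (t : ℤ) (y : ℤ → Bool), z = shiftBy t (cat p w y)}

lemma mem_Cs_iff {p : ℕ} (hp : 0 < p) (w : Bool → ℕ → ℤ) {z : ℤ → ℤ} :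
    z ∈ Cs p w ↔ ∃ (i : ℕ) (y : ℤ → Bool), i < p ∧ z = shiftBy i (cat p w y) := by
  constructor
  · rintro ⟨t, y, rfl⟩
    obtain ⟨j, i, hi, rfl⟩ := exists_block hp t
    exact ⟨i, shiftBy j y, hi, by rw [← cat_shift hp, shiftBy_shiftBy, add_comm]⟩
  · rintro ⟨i, y, _, rfl⟩
    exact ⟨i, y, rfl⟩

lemma compact_Cs {p : ℕ} (hp : 0 < p) (w : Bool → ℕ → ℤ) : IsCompact (Cs p w) := by
  have h : Cs p w = ⋃ i ∈ Finset.range p, range (fun y => shiftBy (i : ℤ) (cat p w y)) := by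
    ext z
    rw [mem_Cs_iff hp]
    simp only [mem_iUnion, mem_range, Finset.mem_range, exists_prop]
    constructor
    · rintro ⟨i, y, hi, rfl⟩
      exact ⟨i, hi, y, rfl⟩
    · rintro ⟨i, hi, y, rfl⟩
      exact ⟨i, y, hi, rfl⟩
  rw [h]
  exact (Finset.range p).isCompact_biUnion
    (fun i _ => isCompact_range ((continuous_shiftBy _).comp (continuous_cat p w)))

/-- The constructed subshift. -/
def XX (l : ℕ) (W0 : Bool → ℕ → ℤ) : Set (ℤ → ℤ) := ⋂ k, Cs (PP l k) (Wd l W0 k)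

lemma XX_sub {l : ℕ} (hl : 0 < l) {W0 : Bool → ℕ → ℤ} {z : ℤ → ℤ} (hz : z ∈ XX l W0) (k : ℕ) :
    ∃ (s : ℤ) (y : ℤ → Bool),
      z = shiftBy s (cat (PP l k) (Wd l W0 k) (subs (k + 6).factorial y)) := by
  obtain ⟨s, y, h⟩ := mem_iInter.1 hz (k + 1)
  exact ⟨s, y, by rw [cat_succ hl, h]⟩

lemma XX_nonempty {l : ℕ} (hl : 0 < l) (W0 : Bool → ℕ → ℤ) : (XX l W0).Nonempty := by
  refine IsCompact.nonempty_iInter_of_sequence_nonempty_isCompact_isClosed _ ?_ ?_ ?_ ?_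
  · rintro k z ⟨t, y, rfl⟩
    exact ⟨t, _, by rw [← cat_succ hl]⟩
  · intro k
    exact ⟨_, 0, fun _ => false, rfl⟩
  · exact compact_Cs (PP_pos hl _) _
  · intro k
    exact (compact_Cs (PP_pos hl _) _).isClosed

lemma XX_compact {l : ℕ} (hl : 0 < l) (W0 : Bool → ℕ → ℤ) : IsCompact (XX l W0) :=
  (compact_Cs (PP_pos hl 0) (Wd l W0 0)).of_isClosed_subset
    (isClosed_iInter (fun k => (compact_Cs (PP_pos hl k) _).isClosed)) (iInter_subset _ 0)

lemma XX_inv (l : ℕ) (W0 : Bool → ℕ → ℤ) : Inv (XX l W0) := by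
  intro k x hx
  refine mem_iInter.2 (fun n => ?_)
  obtain ⟨t, y, rfl⟩ := mem_iInter.1 hx n
  exact ⟨k + t, y, shiftBy_shiftBy _ _ _⟩

lemma XX_mini {l : ℕ} (hl : 0 < l) (W0 : Bool → ℕ → ℤ) : Mini (XX l W0) := by
  intro z hz x hx
  rw [mem_closure_iff]
  intro U hU hxU
  obtain ⟨N, hN⟩ := window_lemma (isCompact_singleton (x := x)) hU (by simpa using hxU)
  let k := 2 * N + 1
  have hk : 2 * N + 1 < PP l k := lt_PP hl k
  obtain ⟨t, y, ht⟩ := mem_iInter.1 hx k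
  obtain ⟨s, y', hs⟩ := XX_sub hl hz k
  obtain ⟨j, i, hi, hji⟩ := exists_block (PP_pos hl k) (t - N)
  obtain ⟨r, hr0, hr1⟩ := subs_pairs (fac_ge k) y' (y j) (y (j + 1))
  refine ⟨shiftBy (r * PP l k + i + N - s) z, ?_, _, rfl⟩
  refine hN x rfl _ (fun q hq => ?_)
  rw [abs_le] at hq
  rw [ht, hs]
  have := cat_agree (p := PP l k) (Wd l W0 k) hr0.symm hr1.symm (i + q + N) (by omega) (by omega)
  simp only [shiftBy]
  convert this using 2
  · omega
  · ring

lemma mul_period {z : ℤ → ℤ} {π : ℤ} (h : ∀ n, z (n + π) = z n) (q : ℕ) :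
    ∀ n, z (n + q * π) = z n := by
  induction q with
  | zero => intro n; simp
  | succ q ih =>
    intro n
    rw [← ih n, ← h (n + q * π)]
    congr 1
    push_cast
    ring

lemma XX_no_period {l : ℕ} (hl : 0 < l) {W0 : Bool → ℕ → ℤ}
    (h : ∃ i, i < l ∧ W0 false i ≠ W0 true i) {z : ℤ → ℤ} (hz : z ∈ XX l W0) (π : ℕ) (hπ : 0 < π)
    (hper : ∀ n, z (n + π) = z n) : False := by
  obtain ⟨s, y, hs⟩ := XX_sub hl hz (π + 1)
  obtain ⟨i, hi, hne⟩ := Wd_ne hl h (π + 1)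
  obtain ⟨r, hr0, hr1⟩ := subs_pairs (fac_ge (π + 1)) y false true
  have hd : π ∣ PP l (π + 1) := Dvd.dvd.mul_right (Nat.dvd_factorial hπ (by omega)) _
  obtain ⟨q, hq⟩ := hd
  have h1 := mul_period hper q (r * PP l (π + 1) + i - s)
  rw [hs] at h1
  simp only [shiftBy] at h1
  have hq2 : (PP l (π + 1) : ℤ) = π * q := by exact_mod_cast hq
  have e1 := cat_val (Wd l W0 (π + 1)) (subs (π + 1 + 6).factorial y)
    (r * PP l (π + 1) + i - s + q * π + s) (r + 1) i hi (by rw [hq2]; ring)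
  have e2 := cat_val (Wd l W0 (π + 1)) (subs (π + 1 + 6).factorial y)
    (r * PP l (π + 1) + i - s + s) r i hi (by ring)
  rw [e1, e2, hr0, hr1] at h1
  exact hne h1.symm

lemma XX_infinite {l : ℕ} (hl : 0 < l) {W0 : Bool → ℕ → ℤ}
    (h : ∃ i, i < l ∧ W0 false i ≠ W0 true i) : (XX l W0).Infinite := by
  obtain ⟨z, hz⟩ := XX_nonempty hl W0
  refine Set.infinite_of_injective_forall_mem (f := fun a : ℤ => shiftBy a z) ?_
    (fun a => XX_inv l W0 a z hz)
  have key : ∀ a b : ℤ, a < b → shiftBy a z = shiftBy b z → False := by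
    intro a b hab heq
    refine XX_no_period hl h hz (b - a).toNat (by omega) (fun n => ?_)
    have := congrFun heq (n - a)
    simp only [shiftBy] at this
    rw [Int.toNat_of_nonneg (by omega)]
    rw [show n + (b - a) = n - a + b by ring, ← this]
    congr 1
    ring
  intro a b hab
  rcases lt_trichotomy a b with h1 | h1 | h1
  · exact (key a b h1 hab).elim
  · exact h1
  · exact (key b a h1 hab.symm).elim

lemma XX_good {l : ℕ} (hl : 0 < l) {W0 : Bool → ℕ → ℤ}
    (h : ∃ i, i < l ∧ W0 false i ≠ W0 true i) (m : ℕ) : Good m (XX l W0) := by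
  set p := PP l (m + 1) with hpdef
  set w := Wd l W0 (m + 1) with hwdef
  have hp : 0 < p := PP_pos hl _
  have hinv := XX_inv l W0
  have hcl : IsClosed (XX l W0) := (XX_compact hl W0).isClosed
  let E0 : Set (ℤ → ℤ) := range (cat p w) ∩ XX l W0
  let F0 : Set (ℤ → ℤ) :=
    (⋃ r ∈ Finset.Ioo 0 p, range (fun y => shiftBy (r : ℤ) (cat p w y))) ∩ XX l W0
  have hE0 : IsCompact E0 := (isCompact_range (continuous_cat p w)).inter_right hcl
  have hF0 : IsCompact F0 := ((Finset.Ioo 0 p).isCompact_biUnion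
    (fun i _ => isCompact_range ((continuous_shiftBy _).comp (continuous_cat p w)))).inter_right hcl
  have memF : ∀ {x : ℤ → ℤ} (r : ℕ) (y : ℤ → Bool), 0 < r → r < p → x = shiftBy r (cat p w y) →
      x ∈ XX l W0 → x ∈ F0 := by
    intro x r y h0 h1 hx hX
    exact ⟨mem_iUnion₂.2 ⟨r, Finset.mem_Ioo.2 ⟨h0, h1⟩, y, hx.symm⟩, hX⟩
  have hdisj : Disjoint E0 F0 := by
    rw [Set.disjoint_left]
    rintro x ⟨⟨y', rfl⟩, hX⟩ ⟨hu, _⟩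
    obtain ⟨s, hs, y, hy⟩ := mem_iUnion₂.1 hu
    rw [Finset.mem_Ioo] at hs
    obtain ⟨q, hq, hper⟩ := two_phases w hs.1 hs.2 (Wd_ne hl h (m + 1)) y y' hy
    have hmem : cat p w y ∈ XX l W0 := by
      have := hinv (-s) _ hX
      rw [← show shiftBy (s : ℤ) (cat p w y) = cat p w y' from hy, shiftBy_shiftBy] at this
      simpa [shiftBy_zero] using this
    exact no_periodic (XX_infinite hl h) (XX_mini hl W0) hmem hq hper
  obtain ⟨E, F, hE, hF, hEE, hFF, hd⟩ := SeparatedNhds.of_isCompact_isCompact hE0 hF0 hdisj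
  refine ⟨p, E, F, cat p w (fun _ => false), cat p w (fun _ => true),
    cat (PP l m) (Wd l W0 m) (fun _ => false), hE, hF, hd,
    lt_trans (Nat.lt_succ_self m) (lt_PP hl (m + 1)), ?_, ?_⟩
  · intro q hq hqm
    exact Dvd.dvd.mul_right (Nat.dvd_factorial hq (by omega)) _
  intro x hX
  obtain ⟨i, y, hi, hxy⟩ := (mem_Cs_iff hp w).1 (mem_iInter.1 hX (m + 1))
  rcases Nat.eq_zero_or_pos i with rfl | hipos
  · have hx : x = cat p w y := by rw [hxy, Nat.cast_zero, shiftBy_zero]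
    have hxE : x ∈ E := hEE ⟨⟨y, hx.symm⟩, hX⟩
    refine ⟨⟨0, hp, by rw [Nat.cast_zero, shiftBy_zero]; exact hxE⟩, Or.inr ⟨hxE, ?_, ?_, ?_, ?_⟩⟩
    · intro r hr hr0
      exact hFF (memF r y hr0 hr (by rw [hx]) (hinv _ _ hX))
    · refine hEE ⟨⟨shiftBy 1 y, ?_⟩, hinv _ _ hX⟩
      rw [← cat_shift hp, one_mul, hx]
    · have hv : ∀ (u : ℤ → Bool) (i : ℕ), i < p → cat p w u i = w (u 0) i := fun u i hi =>
        cat_val w u _ 0 i hi (by simp)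
      cases hy0 : y 0
      · left
        intro i hi
        rw [hx, hv y i hi, hv _ i hi, hy0]
      · right
        intro i hi
        rw [hx, hv y i hi, hv _ i hi, hy0]
    · intro i hi
      rw [Finset.mem_Ico] at hi
      have hm := lt_PP hl m
      have h6 := fac_ge m
      rw [hx, ← cat_succ hl]
      have e0 : subs (m + 6).factorial y (-1) = (fun _ : ℤ => false) (-1) := by
        rw [subs_val y (-1) (-1) ((m + 6).factorial - 1) (by omega) (by omega)]
        simp [tau]; omega
      have e1 : subs (m + 6).factorial y (-1 + 1) = (fun _ : ℤ => false) (-1 + 1) := by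
        rw [subs_val y (-1 + 1) 0 0 (by omega) (by simp)]
        simp [tau]
      have := cat_agree (p := PP l m) (Wd l W0 m) (u := subs (m + 6).factorial y)
        (v := fun _ => false) (j := -1) (r := -1) e0 e1 (i + PP l m) (by omega) (by omega)
      rwa [show -1 * (PP l m : ℤ) + (i + PP l m) = i by ring] at this
  · refine ⟨⟨p - i, by omega, hEE ⟨⟨shiftBy 1 y, ?_⟩, hinv _ _ hX⟩⟩,
      Or.inl (hFF (memF i y hipos hi hxy hX))⟩
    rw [← cat_shift hp, hxy, shiftBy_shiftBy]
    congr 1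
    omega

/-! ### Initial words and density -/

lemma init_words {Y : Set (ℤ → ℤ)} (hne : Y.Nonempty) (hc : IsCompact Y) (hi : Inv Y)
    (hm : Mini Y) (hinf : Y.Infinite) (N : ℕ) :
    ∃ (l : ℕ) (W0 : Bool → ℕ → ℤ), 0 < l ∧ (∃ i, i < l ∧ W0 false i ≠ W0 true i) ∧
      (∀ (u : ℤ → Bool) (n : ℤ), ∃ y ∈ Y, ∃ j : ℤ, ∀ k : ℕ, k < N → cat l W0 u (n + k) = y (j + k)) ∧
      (∀ (u : ℤ → Bool), ∀ z ∈ Y, ∃ n : ℤ, ∀ k : ℕ, k < N → cat l W0 u (n + k) = z k) := by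
  obtain ⟨y, hy⟩ := hne
  have agree : ∀ z : ℤ → ℤ, IsOpen {x : ℤ → ℤ | ∀ i : ℕ, i < N → x i = z i} := by
    intro z
    have := isOpen_biInter_finset (s := Finset.range N)
      (f := fun i : ℕ => {x : ℤ → ℤ | x i = z i}) (fun i _ => isOpen_coord i _)
    convert this using 1
    ext x; simp
  have claimA : ∀ L : ℕ, 0 < L → ∃ i : ℕ, y (i + L) ≠ y i := by
    intro L hL
    by_contra hcon
    push Not at hcon
    have hU : IsOpen {z : ℤ → ℤ | z L ≠ z 0} := by
      have : IsClosed {z : ℤ → ℤ | z L = z 0} :=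
        isClosed_eq (continuous_apply _) (continuous_apply _)
      exact this.isOpen_compl
    by_cases hn : (Y ∩ {z : ℤ → ℤ | z L ≠ z 0}).Nonempty
    · obtain ⟨M, hM⟩ := syndetic hc hi hm hU hn
      obtain ⟨j, _, hj⟩ := hM y hy
      apply hj
      simp only [shiftBy]
      rw [zero_add, add_comm]
      exact hcon j
    · refine no_periodic hinf hm hy (p := L) (by exact_mod_cast hL) (fun i => ?_)
      by_contra h2
      refine hn ⟨shiftBy i y, hi _ _ hy, ?_⟩
      simp only [mem_ofPred_eq, shiftBy, zero_add]
      rwa [add_comm]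
  have ret : ∀ K : ℕ, ∃ n : ℕ, K ≤ n ∧ ∀ k : ℕ, k < N → y ((n : ℤ) + k) = y k := by
    intro K
    obtain ⟨M, hM⟩ := syndetic hc hi hm (agree y) ⟨y, hy, fun _ _ => rfl⟩
    obtain ⟨j, _, hj⟩ := hM (shiftBy K y) (hi _ _ hy)
    refine ⟨j + K, by omega, fun k hk => ?_⟩
    rw [← hj k hk]
    simp only [shiftBy]
    congr 1
    push_cast
    ring
  have cover : ∃ K : ℕ, ∀ z ∈ Y, ∃ n : ℕ, n < K ∧ ∀ k : ℕ, k < N → z k = y ((n : ℤ) + k) := by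
    have h1 : Y ⊆ ⋃ n : ℕ, {x : ℤ → ℤ | ∀ i : ℕ, i < N → x i = shiftBy n y i} := by
      intro z hz
      obtain ⟨M, hM⟩ := syndetic hc hi hm (agree z) ⟨z, hz, fun _ _ => rfl⟩
      obtain ⟨j, _, hj⟩ := hM y hy
      exact mem_iUnion.2 ⟨j, fun k hk => (hj k hk).symm⟩
    obtain ⟨t, ht⟩ := hc.elim_finite_subcover _ (fun n => agree _) h1
    refine ⟨t.sup id + 1, fun z hz => ?_⟩
    obtain ⟨n, hn, hzn⟩ := mem_iUnion₂.1 (ht hz)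
    have : n ≤ t.sup id := Finset.le_sup (f := id) hn
    refine ⟨n, by omega, fun k hk => ?_⟩
    rw [hzn k hk, shiftBy, add_comm]
  obtain ⟨K, hK⟩ := cover
  obtain ⟨L, hLK, hL⟩ := ret (K + N + 1)
  obtain ⟨i0, hi0⟩ := claimA L (by omega)
  obtain ⟨M, hMK, hM⟩ := ret (i0 + L + N + 1)
  let W0 : Bool → ℕ → ℤ := fun b n =>
    if b then (if n < M then y n else y ((n : ℤ) - M)) else (if n < L then y n else y ((n : ℤ) - L))
  have hW : ∀ b, ∃ a c : ℕ, a + c = L + M ∧ L ≤ a ∧ L ≤ c ∧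
      (∀ k : ℕ, k < N → y ((a : ℤ) + k) = y k) ∧ (∀ k : ℕ, k < N → y ((c : ℤ) + k) = y k) ∧
      ∀ n : ℕ, W0 b n = if n < a then y n else y ((n : ℤ) - a) := by
    intro b
    cases b
    · exact ⟨L, M, rfl, le_rfl, by omega, hL, hM, fun n => by simp [W0]⟩
    · exact ⟨M, L, by omega, by omega, le_rfl, hM, hL, fun n => by simp [W0]⟩
  have hWs : ∀ b (n : ℕ), n < L → W0 b n = y n := by
    intro b n hn
    obtain ⟨a, c, _, h2, _, _, _, h6⟩ := hW b
    rw [h6, if_pos (by omega)]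
  refine ⟨L + M, W0, by omega, ⟨L + i0, by omega, ?_⟩, ?_, ?_⟩
  · simp only [W0]
    simp only [Bool.false_eq_true, if_false, if_true]
    rw [if_neg (by omega), if_pos (by omega)]
    intro hcon
    apply hi0
    rw [add_comm (i0 : ℤ)]
    push_cast at hcon
    rw [← hcon]
    congr 1
    ring
  · intro u n
    obtain ⟨j, i, hil, rfl⟩ := exists_block (show 0 < L + M by omega) n
    obtain ⟨a, c, hac, haL, hcL, ha, hcc, hw⟩ := hW (u j)
    by_cases hia : i < a
    · refine ⟨y, hy, i, fun k hk => ?_⟩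
      rw [cat_val W0 u _ j (i + k) (by omega) (by push_cast; ring), hw]
      split_ifs with h1
      · push_cast; rfl
      · have h2 := ha (i + k - a) (by omega)
        rw [show ((i + k : ℕ) : ℤ) - a = ((i + k - a : ℕ) : ℤ) by omega, ← h2]
        congr 1
        omega
    · refine ⟨y, hy, (i : ℤ) - a, fun k hk => ?_⟩
      by_cases hik : i + k < L + M
      · rw [cat_val W0 u _ j (i + k) (by omega) (by push_cast; ring), hw, if_neg (by omega)]
        congr 1
        push_cast
        ring
      · rw [cat_val W0 u _ (j + 1) (i + k - (L + M)) (by omega)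
          (by push_cast [Nat.cast_sub (show L + M ≤ i + k by omega)]; ring),
          hWs _ _ (by omega), ← hcc _ (by omega)]
        congr 1
        omega
  · intro u z hz
    obtain ⟨n, hn, hzn⟩ := hK z hz
    refine ⟨n, fun k hk => ?_⟩
    rw [cat_val W0 u _ 0 (n + k) (by omega) (by push_cast; ring), hWs _ _ (by omega), hzn k hk]
    push_cast
    rfl

lemma dense_step {Y : Set (ℤ → ℤ)} (hne : Y.Nonempty) (hc : IsCompact Y) (hi : Inv Y)
    (hm : Mini Y) (hinf : Y.Infinite) (N : ℕ) :
    ∃ X : SubshiftSpace, X ∈ MinimalSet ∧ (∀ m, Good m X.carrier) ∧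
      ∀ n ≤ N, Lang n X.carrier = Lang n Y := by
  obtain ⟨l, W0, hl, hd, h1, h2⟩ := init_words hne hc hi hm hinf N
  refine ⟨⟨XX l W0, XX_nonempty hl W0, XX_compact hl W0, image_of_inv (XX_inv l W0)⟩,
    ⟨XX_infinite hl hd, XX_mini hl W0⟩, XX_good hl hd, fun n hn => ?_⟩
  apply Set.Subset.antisymm
  · rintro v ⟨x, hx, i, rfl⟩
    obtain ⟨t, u, rfl⟩ := mem_iInter.1 hx 0
    obtain ⟨y, hy, j, hj⟩ := h1 u (i + t)
    refine ⟨y, hy, j, ?_⟩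
    rw [factorAt_eq_iff]
    intro k hk
    rw [← hj k (by omega)]
    simp only [shiftBy]
    show cat l W0 u _ = cat l W0 u _
    congr 1
    ring
  · rintro v ⟨y, hy, i, rfl⟩
    obtain ⟨x, hx⟩ := XX_nonempty hl W0
    obtain ⟨t, u, rfl⟩ := mem_iInter.1 hx 0
    obtain ⟨m, hmm⟩ := h2 u (shiftBy i y) (hi _ _ hy)
    refine ⟨_, hx, m - t, ?_⟩
    rw [factorAt_eq_iff]
    intro k hk
    have := hmm k (by omega)
    simp only [shiftBy] at this ⊢
    rw [add_comm i, ← this]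
    show cat l W0 u _ = cat l W0 u _
    congr 1
    ring

/-- In the Polish space `𝐌` of infinite minimal subshifts, the set of
strong Toeplitz subshifts of rank 2 contains a dense `G_δ` subset (so is comeager). -/
theorem statement9 :
    ∃ G : Set ↥MinimalSet, IsGδ G ∧ Dense G ∧
      ∀ X ∈ G, IsStrongToeplitzOfRank (X : SubshiftSpace).carrier 2 := by
  refine ⟨⋂ m : ℕ, {X : ↥MinimalSet | Good m (X : SubshiftSpace).carrier}, ?_, ?_, ?_⟩
  · exact IsGδ.iInter_of_isOpen (fun m => (isOpen_good m).preimage continuous_subtype_val)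
  · rw [dense_iff_inter_open]
    rintro U hU ⟨⟨Y, hY⟩, hYU⟩
    obtain ⟨V, hV, rfl⟩ := isOpen_induced_iff.1 hU
    obtain ⟨N, hN⟩ := open_nbhd hV (Y := Y) hYU
    obtain ⟨X, hXM, hXG, hXL⟩ := dense_step Y.nonempty Y.compact (inv_of_image Y.invariant)
      hY.2 hY.1 N
    exact ⟨⟨X, hXM⟩, hN X hXL, mem_iInter.2 hXG⟩
  · intro X hX
    exact strong_of_good X.1.nonempty X.1.compact (inv_of_image X.1.invariant) X.2.2
      (fun m => mem_iInter.1 hX m)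

end ToeplitzFR
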